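/- arXiv:0710.1410 — 7 statements merged into one kernel-verified Lean document; each statement's English description precedes it below -/
import Mathlib

section
/- Let X be a second countable, locally compact Hausdorff topological space and H an infinite-dimensional separable complex Hilbert space. Then the unitary group of the C*-algebra C_b(X, B(H)) of bounded norm-continuous functions from X to the bounded linear operators on H, equipped with the supremum-norm topology, is a contractible topological space. -/
open Topology

/-- Two elements of a topological ring are unit-joined if a path of units connects them. -/
def UnitJoined {B : Type*} [Ring B] [TopologicalSpace B] (x y : B) : Prop :=
  JoinedIn {z : B | IsUnit z} x y

namespace UnitJoined

variable {B : Type*} [Ring B] [TopologicalSpace B]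

theorem refl {x : B} (hx : IsUnit x) : UnitJoined x x := JoinedIn.refl hx

theorem symm {x y : B} (h : UnitJoined x y) : UnitJoined y x := JoinedIn.symm h

theorem trans {x y z : B} (h : UnitJoined x y) (h' : UnitJoined y z) : UnitJoined x z :=
  JoinedIn.trans h h'

theorem isUnit_left {x y : B} (h : UnitJoined x y) : IsUnit x := h.source_mem

theorem isUnit_right {x y : B} (h : UnitJoined x y) : IsUnit y := h.target_mem

theorem mul [ContinuousMul B] {x y x' y' : B} (h : UnitJoined x y) (h' : UnitJoined x' y') :
    UnitJoined (x * x') (y * y') := by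
  refine JoinedIn.mono (JoinedIn.mul h h') ?_
  rintro _ ⟨a, ha, b, hb, rfl⟩
  exact IsUnit.mul ha hb

theorem map {C : Type*} [Ring C] [TopologicalSpace C] {x y : B} (h : UnitJoined x y) {g : B → C}
    (hg : Continuous g) (hu : ∀ z, IsUnit z → IsUnit (g z)) : UnitJoined (g x) (g y) := by
  refine JoinedIn.mono (JoinedIn.map h hg) ?_
  rintro _ ⟨a, ha, rfl⟩
  exact hu a ha

theorem of_mul_right [ContinuousMul B] {x v : B} (hv : IsUnit v) (h : UnitJoined (x * v) v) :
    UnitJoined x 1 := by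
  obtain ⟨v, rfl⟩ := hv
  simpa [mul_assoc] using h.mul (refl (v⁻¹).isUnit)

theorem of_intertwine [ContinuousMul B] {r x y : B} (hr : UnitJoined r 1) (hx : IsUnit x)
    (h : r * x = y * r) : UnitJoined x y := by
  have hy : IsUnit y := by
    have hyr : IsUnit (y * r) := h ▸ hr.isUnit_left.mul hx
    obtain ⟨u, rfl⟩ := hr.isUnit_left
    exact (Units.isUnit_mul_units y u).1 hyr
  have h1 := hr.mul (refl hx)
  have h2 := (refl hy).mul hr
  rw [one_mul] at h1
  rw [mul_one] at h2
  exact h1.symm.trans (h ▸ h2)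

variable [Algebra ℝ B] [IsTopologicalRing B] [ContinuousSMul ℝ B]

/-- The quarter turn given by a pair of off-diagonal matrix units. -/
theorem rotation {e f : B} (he : e * e = 0) (hf : f * f = 0)
    (hefe : e * f * e = e) (hfef : f * e * f = f) :
    UnitJoined (1 - e * f - f * e + f - e) 1 := by
  set P := e * f + f * e with hP
  set J := f - e with hJ
  have hPP : P * P = P := by
    have h1 : e * f * (e * f) = e * f := by rw [← mul_assoc, hefe]
    have h2 : f * e * (f * e) = f * e := by rw [← mul_assoc, hfef]
    have h3 : e * f * (f * e) = 0 := by rw [mul_assoc, ← mul_assoc f f, hf]; simp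
    have h4 : f * e * (e * f) = 0 := by rw [mul_assoc, ← mul_assoc e e, he]; simp
    simp only [hP, mul_add, add_mul, h1, h2, h3, h4]; abel
  have hPJ : P * J = J := by
    have h3 : e * f * f = 0 := by rw [mul_assoc, hf, mul_zero]
    have h4 : f * e * e = 0 := by rw [mul_assoc, he, mul_zero]
    simp only [hP, hJ, mul_sub, add_mul, hefe, hfef, h3, h4]; abel
  have hJP : J * P = J := by
    have h1 : f * (f * e) = 0 := by rw [← mul_assoc, hf, zero_mul]
    have h2 : e * (e * f) = 0 := by rw [← mul_assoc, he, zero_mul]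
    simp only [hP, hJ, sub_mul, mul_add, ← mul_assoc e f e, ← mul_assoc f e f, hefe, hfef, h1, h2]
    abel
  have hJJ : J * J = -P := by
    simp only [hP, hJ, sub_mul, mul_sub, he, hf]; abel
  have key : ∀ c s : ℝ, c ^ 2 + s ^ 2 = 1 →
      (1 - P + c • P + s • J) * (1 - P + c • P + (-s) • J) = 1 := by
    intro c s hcs
    simp only [mul_add, add_mul, mul_sub, sub_mul, one_mul, mul_one, smul_mul_assoc,
      mul_smul_comm, hPP, hPJ, hJP, hJJ, smul_neg]
    trans 1 - P + (c ^ 2 + s ^ 2) • P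
    · module
    · rw [hcs, one_smul, sub_add_cancel]
  refine JoinedIn.symm (JoinedIn.ofLine
    (f := fun t : ℝ ↦ 1 - P + Real.cos (Real.pi / 2 * t) • P + Real.sin (Real.pi / 2 * t) • J)
    (by fun_prop) (by simp) (by simp [hP, hJ]; abel) ?_)
  rintro _ ⟨t, -, rfl⟩
  have h1 := key _ _ (Real.cos_sq_add_sin_sq (Real.pi / 2 * t))
  have h2 := key (Real.cos (Real.pi / 2 * t)) (-Real.sin (Real.pi / 2 * t))
    (by simp)
  rw [neg_neg] at h2
  exact ⟨⟨_, _, h1, h2⟩, rfl⟩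

/-- Moving a compression of a unit between two orthogonal equivalent corners. -/
theorem of_orthogonal_corners {p x₁ y₁ x₂ y₂ w : B} (h₁ : y₁ * x₁ = p) (h₂ : y₂ * x₂ = p)
    (h₁₂ : y₁ * x₂ = 0) (h₂₁ : y₂ * x₁ = 0) (hx₁ : x₁ * p = x₁) (hx₂ : x₂ * p = x₂)
    (hy₁ : p * y₁ = y₁) (hy₂ : p * y₂ = y₂)
    (hu : IsUnit (1 - x₁ * (1 - w) * y₁)) :
    UnitJoined (1 - x₁ * (1 - w) * y₁) (1 - x₂ * (1 - w) * y₂) := by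
  have hef : x₁ * y₂ * (x₂ * y₁) = x₁ * y₁ := by
    rw [mul_assoc, ← mul_assoc y₂, h₂, ← mul_assoc, hx₁]
  have hfe : x₂ * y₁ * (x₁ * y₂) = x₂ * y₂ := by
    rw [mul_assoc, ← mul_assoc y₁, h₁, ← mul_assoc, hx₂]
  have hR := rotation (e := x₁ * y₂) (f := x₂ * y₁)
    (by rw [mul_assoc, ← mul_assoc y₂, h₂₁]; simp) (by rw [mul_assoc, ← mul_assoc y₁, h₁₂]; simp)
    (by rw [hef, mul_assoc, ← mul_assoc y₁, h₁, hy₂])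
    (by rw [hfe, mul_assoc, ← mul_assoc y₂, h₂, hy₁])
  rw [hef, hfe] at hR
  refine of_intertwine hR hu ?_
  have hRx : (1 - x₁ * y₁ - x₂ * y₂ + x₂ * y₁ - x₁ * y₂) * x₁ = x₂ := by
    simp only [add_mul, sub_mul, mul_assoc, h₁, h₂₁, one_mul, hx₁, hx₂, mul_zero]; abel
  have hyR : y₂ * (1 - x₁ * y₁ - x₂ * y₂ + x₂ * y₁ - x₁ * y₂) = y₁ := by
    simp only [mul_add, mul_sub, ← mul_assoc, h₂, h₂₁, mul_one, hy₁, hy₂, zero_mul]; abel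
  have expand : ∀ g z z' : B, g * z = z' * g → g * (1 - z) = (1 - z') * g := by
    intro g z z' h
    rw [mul_sub, sub_mul, h, mul_one, one_mul]
  refine expand _ _ _ ?_
  rw [mul_assoc _ _ (_ - _), hyR, ← mul_assoc, ← mul_assoc, hRx]

/-- Two left invertible elements with mutually annihilating left inverses differ by a unit
in the identity component. -/
theorem exists_mul_eq {a b c d : B} (hba : b * a = 1) (hdc : d * c = 1) (hbc : b * c = 0)
    (hda : d * a = 0) : ∃ r, UnitJoined r 1 ∧ r * a = c := by
  have hef : a * d * (c * b) = a * b := by rw [mul_assoc, ← mul_assoc d, hdc, one_mul]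
  have hfe : c * b * (a * d) = c * d := by rw [mul_assoc, ← mul_assoc b, hba, one_mul]
  refine ⟨_, rotation (e := a * d) (f := c * b)
    (by rw [mul_assoc, ← mul_assoc d, hda]; simp) (by rw [mul_assoc, ← mul_assoc b, hbc]; simp)
    (by rw [hef, mul_assoc, ← mul_assoc b, hba, one_mul])
    (by rw [hfe, mul_assoc, ← mul_assoc d, hdc, one_mul]), ?_⟩
  rw [hef, hfe]
  simp only [add_mul, sub_mul, mul_assoc, hba, hda, one_mul, mul_one, mul_zero]; abel

omit [TopologicalSpace B] [Algebra ℝ B] [IsTopologicalRing B] [ContinuousSMul ℝ B] in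
theorem isUnit_corner {x y w : B} (h : y * x = 1) (hw : IsUnit w) :
    IsUnit (1 - x * (1 - w) * y) := by
  obtain ⟨w, rfl⟩ := hw
  have key : ∀ v : Bˣ, (1 - x * (1 - (v : B)) * y) * (1 - x * (1 - (↑v⁻¹ : B)) * y) = 1 := by
    intro v
    have : x * (1 - (v : B)) * y * (x * (1 - (↑v⁻¹ : B)) * y)
        = x * (1 - (v : B)) * y + x * (1 - (↑v⁻¹ : B)) * y := by
      calc _ = x * (1 - (v : B)) * (y * x) * (1 - (↑v⁻¹ : B)) * y := by simp only [mul_assoc]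
        _ = x * ((1 - (v : B)) * (1 - (↑v⁻¹ : B))) * y := by rw [h]; simp only [mul_assoc, one_mul]
        _ = _ := by
          rw [← add_mul, ← mul_add]
          congr 2
          simp only [mul_sub, sub_mul, Units.mul_inv, one_mul, mul_one]; abel
    rw [one_sub_mul, mul_one_sub (x * (1 - (v : B)) * y), this]; abel
  exact ⟨⟨_, _, key w, by simpa using key w⁻¹⟩, rfl⟩

/-- The Eilenberg swindle for an infinite amplification `φ`. -/
theorem swindle {s s' t t' : B} (hs : s' * s = 1) (ht : t' * t = 1) (hst : s' * t = 0)
    (hts : t' * s = 0) (φ : B →* B) (hφ : ∀ x, φ x = s * x * s' + t * φ x * t')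
    {u : B} (hu : IsUnit u) : UnitJoined (1 - s * s * (1 - u) * (s' * s')) 1 := by
  have hone : s * s' + t * t' = 1 := by simpa using (hφ 1).symm
  have hΦ : IsUnit (φ u) := hu.map φ
  have hss : s' * s' * (s * s) = 1 := by rw [mul_assoc, ← mul_assoc s' s s, hs, one_mul, hs]
  have hstst : t' * s' * (s * t) = 1 := by rw [mul_assoc, ← mul_assoc s' s t, hs, one_mul, ht]
  have hfac : 1 - s * (1 - φ u) * s' = (1 - s * s * (1 - u) * (s' * s')) *
      (1 - s * t * (1 - φ u) * (t' * s')) := by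
    have h0 : s' * s' * (s * t) = 0 := by rw [mul_assoc, ← mul_assoc s' s t, hs, one_mul, hst]
    have hz : s * s * (1 - u) * (s' * s') * (s * t * (1 - φ u) * (t' * s')) = 0 := by
      calc _ = s * s * (1 - u) * (s' * s' * (s * t)) * (1 - φ u) * (t' * s') := by
            simp only [mul_assoc]
        _ = 0 := by rw [h0]; simp
    have hsum : s * (1 - φ u) * s' = s * s * (1 - u) * (s' * s') +
        s * t * (1 - φ u) * (t' * s') := by
      have : 1 - φ u = s * (1 - u) * s' + t * (1 - φ u) * t' := by
        conv_lhs => rw [hφ u, ← hone]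
        simp only [mul_sub, sub_mul, mul_one]; abel
      conv_lhs => rw [this]
      simp only [mul_add, add_mul, mul_assoc]
    rw [one_sub_mul, mul_one_sub (s * s * (1 - u) * (s' * s')), hz, hsum]; abel
  have hA : UnitJoined (1 - s * t * (1 - φ u) * (t' * s')) (1 - t * (1 - φ u) * t') :=
    of_orthogonal_corners (p := 1) hstst ht (by rw [mul_assoc, hst, mul_zero])
      (by rw [← mul_assoc, hts, zero_mul]) (by simp) (by simp) (by simp) (by simp)
      (isUnit_corner hstst hΦ)
  have hB : UnitJoined (1 - t * (1 - φ u) * t') (1 - s * (1 - φ u) * s') :=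
    of_orthogonal_corners (p := 1) ht hs hts hst (by simp) (by simp) (by simp) (by simp)
      (isUnit_corner ht hΦ)
  have hC := (refl (isUnit_corner hss hu)).mul (hA.trans hB)
  rw [← hfac] at hC
  exact of_mul_right (isUnit_corner hs hΦ) hC.symm

/-- Kuiper's argument in a ring with an infinite amplification: a unit which admits room
`c` transverse to both `a` and its image is in the identity component. -/
theorem one_of_room {s s' t t' : B} (hs : s' * s = 1) (ht : t' * t = 1) (hst : s' * t = 0)
    (hts : t' * s = 0) (φ : B →* B) (hφ : ∀ x, φ x = s * x * s' + t * φ x * t')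
    {u a b c d : B} (hu : IsUnit u) (hba : b * a = 1) (hdc : d * c = 1) (hda : d * a = 0)
    (hdua : d * u * a = 0) : UnitJoined u 1 := by
  -- Reduce to a unit fixing `a`.
  obtain ⟨v, hv, hva⟩ : ∃ v, UnitJoined u v ∧ v * a = a := by
    obtain ⟨u, rfl⟩ := hu
    have hz : (1 - c * d) * c = 0 := by rw [sub_mul, mul_assoc, hdc]; simp
    obtain ⟨r₁, hr₁, h₁⟩ := exists_mul_eq (a := (u : B) * a) (b := b * ↑u⁻¹ * (1 - c * d))
      (c := c) (d := d)
      (by rw [mul_assoc, sub_mul, mul_assoc c d, ← mul_assoc d, hdua]; simp [mul_assoc, hba])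
      hdc (by rw [mul_assoc, hz, mul_zero]) (by rw [← mul_assoc, hdua])
    obtain ⟨r₂, hr₂, h₂⟩ := exists_mul_eq (a := c) (b := d) (c := a) (d := b * (1 - c * d))
      hdc (by rw [mul_assoc, sub_mul, mul_assoc c, hda]; simp [hba]) hda
      (by rw [mul_assoc, hz, mul_zero])
    refine ⟨r₂ * r₁ * u, ?_, by rw [mul_assoc, mul_assoc, h₁, h₂]⟩
    simpa using ((hr₂.mul hr₁).mul (refl u.isUnit)).symm
  refine hv.trans ?_
  -- Remove the off-diagonal part.
  obtain ⟨q, hq⟩ : ∃ q, q = 1 - a * b := ⟨_, rfl⟩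
  have hqa : q * a = 0 := by rw [hq, sub_mul, mul_assoc, hba]; simp
  have hbq : b * q = 0 := by rw [hq, mul_sub, ← mul_assoc, hba]; simp
  have hqq : q * q = q := by
    nth_rewrite 1 [hq]
    rw [sub_mul, one_mul, mul_assoc, hbq, mul_zero, sub_zero]
  set n := a * b * v * q with hn
  have hnn : n * n = 0 := by
    have : q * (a * b) = 0 := by rw [← mul_assoc, hqa, zero_mul]
    calc n * n = a * b * v * (q * (a * b)) * v * q := by simp only [hn, mul_assoc]
      _ = 0 := by rw [this]; simp
  have hvn : v * n = n := by simp only [hn, ← mul_assoc, hva]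
  have hw : UnitJoined v (v - n) := by
    have h1 : UnitJoined (1 : B) (1 - n) := by
      refine JoinedIn.ofLine (f := fun t : ℝ ↦ 1 - t • n) (by fun_prop) (by simp) (by simp) ?_
      rintro _ ⟨t, -, rfl⟩
      have key : ∀ t : ℝ, (1 - t • n) * (1 - (-t) • n) = 1 := by
        intro t
        simp [sub_mul, mul_add, hnn]
      exact ⟨⟨_, _, key t, by simpa using key (-t)⟩, rfl⟩
    simpa [mul_sub, hvn] using (refl hv.isUnit_right).mul h1
  refine hw.trans ?_
  set w := v - n with hw'
  have hvq : v = v * a * b + v * q := by rw [hq, mul_sub v, mul_one, ← mul_assoc]; abel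
  have hqw : w = 1 - q * (1 - w) * q := by
    have h1 : w = a * b + q * v * q := by
      rw [hw', hn]
      conv_lhs => rw [hvq, hva]
      have : (q : B) * v * q = v * q - a * b * v * q := by
        nth_rewrite 1 [hq]
        simp only [sub_mul, one_mul]
      rw [this]
      have h3 : a * b * (a * b + v * q) * q = a * b * v * q := by
        rw [mul_add, add_mul, mul_assoc (a * b) (a * b), mul_assoc a b q, hbq]
        simp [mul_assoc, hqq]
      rw [h3]; abel
    have h2 : q * w * q = q * v * q := by
      rw [h1, mul_add, add_mul, ← mul_assoc q a, hqa, ← mul_assoc, ← mul_assoc, hqq,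
        mul_assoc _ q q, hqq]
      simp
    rw [mul_sub q, sub_mul, mul_one, hqq, h2, h1]
    conv_lhs => rw [show a * b = 1 - q by rw [hq]; abel]
    abel
  have hwu : IsUnit w := hw.isUnit_right
  -- Move it into the room and swindle.
  have hss : s' * s' * (s * s) = 1 := by rw [mul_assoc, ← mul_assoc s' s s, hs, one_mul, hs]
  have hmove := of_orthogonal_corners (p := q) (x₁ := q) (y₁ := q) (x₂ := a * s * s * q)
    (y₂ := q * s' * s' * b) (w := w) hqq
    (by
      calc _ = q * (s' * s' * (b * a) * (s * s)) * q := by simp only [mul_assoc]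
        _ = q := by rw [hba, mul_one, hss, mul_one, hqq])
    (by simp only [← mul_assoc, hqa, zero_mul]) (by simp only [mul_assoc, hbq, mul_zero])
    hqq (by rw [mul_assoc, hqq]) hqq (by simp only [← mul_assoc, hqq]) (hqw ▸ hwu)
  rw [← hqw] at hmove
  have hcorner : q * (1 - w) * q = 1 - w := by
    conv_rhs => rw [hqw]
    abel
  have hE : 1 - a * s * s * q * (1 - w) * (q * s' * s' * b)
      = 1 - a * (1 - (1 - s * s * (1 - w) * (s' * s'))) * b := by
    rw [sub_sub_cancel]
    conv_rhs => rw [← hcorner]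
    simp only [mul_assoc]
  rw [hE] at hmove
  refine hmove.trans ?_
  simpa using (swindle hs ht hst hts φ hφ hwu).map (g := fun z ↦ 1 - a * (1 - z) * b)
    (by fun_prop) (fun z hz ↦ isUnit_corner hba hz)

end UnitJoined

section HilbertSpace

variable {H : Type*} [NormedAddCommGroup H] [InnerProductSpace ℂ H]

theorem Orthonormal.countable_index {ι : Type*} {v : ι → H} (hv : Orthonormal ℂ v)
    [TopologicalSpace.SeparableSpace H] : Countable ι := by
  have hd : (Set.univ : Set ι).PairwiseDisjoint fun i ↦ Metric.ball (v i) (1 / 2) := by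
    intro i _ j _ hij
    refine Metric.ball_disjoint_ball ?_
    have h0 : inner ℂ (v i) (v j) = 0 := hv.2 hij
    have h1 := @norm_sub_sq ℂ H _ _ _ (v i) (v j)
    rw [h0, hv.1 i, hv.1 j] at h1
    norm_num at h1
    rw [dist_eq_norm]
    nlinarith [norm_nonneg (v i - v j)]
  exact Set.countable_univ_iff.1 (hd.countable_of_isOpen (fun i _ ↦ Metric.isOpen_ball)
    (fun i _ ↦ ⟨v i, Metric.mem_ball_self (by norm_num)⟩))

theorem exists_orthogonal_unit_vector (hH : ¬ FiniteDimensional ℂ H) {s : Set H}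
    (hs : s.Finite) : ∃ v : H, ‖v‖ = 1 ∧ ∀ x ∈ s, inner ℂ x v = 0 := by
  have hfin : FiniteDimensional ℂ (Submodule.span ℂ s) := FiniteDimensional.span_of_finite ℂ hs
  have hne : (Submodule.span ℂ s)ᗮ ≠ ⊥ := by
    intro h
    have htop : Submodule.span ℂ s = ⊤ := Submodule.orthogonal_eq_bot_iff.1 h
    rw [htop] at hfin
    exact hH (Module.Finite.of_surjective (⊤ : Submodule ℂ H).subtype
      (fun x ↦ ⟨⟨x, trivial⟩, rfl⟩))
  obtain ⟨w, hw, hw0⟩ := Submodule.exists_mem_ne_zero_of_ne_bot hne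
  refine ⟨((‖w‖⁻¹ : ℝ) : ℂ) • w, ?_, fun x hx ↦ ?_⟩
  · rw [norm_smul]
    simp [hw0]
  · rw [inner_smul_right, hw x (Submodule.subset_span hx), mul_zero]

variable [CompleteSpace H]

theorem exists_nat_hilbertBasis [TopologicalSpace.SeparableSpace H]
    (hH : ¬ FiniteDimensional ℂ H) : Nonempty (HilbertBasis ℕ ℂ H) := by
  obtain ⟨w, b, hb⟩ := exists_hilbertBasis ℂ H
  have hc : Countable w := b.orthonormal.countable_index
  have hi : Infinite w := by
    by_contra hfin
    rw [not_infinite_iff_finite] at hfin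
    obtain ⟨v, hv1, hv⟩ := exists_orthogonal_unit_vector hH (Set.finite_range b)
    have h0 : b.repr v = 0 := by
      ext i
      rw [b.repr_apply_apply, hv _ ⟨i, rfl⟩]
      rfl
    have : v = 0 := by simpa using h0
    simp [this] at hv1
  obtain ⟨e⟩ := nonempty_equiv_of_countable (α := ℕ) (β := w)
  refine ⟨HilbertBasis.mk (v := b ∘ e) (b.orthonormal.comp e e.injective) ?_⟩
  rw [e.surjective.range_comp]
  exact b.dense_span.ge

omit [CompleteSpace H] in
theorem HilbertBasis.clm_ext {F : Type*} [NormedAddCommGroup F] [NormedSpace ℂ F] {ι : Type*}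
    (b : HilbertBasis ι ℂ H) {S T : H →L[ℂ] F} (h : ∀ i, S (b i) = T (b i)) : S = T := by
  refine ContinuousLinearMap.ext_on (s := Set.range b) ?_ ?_
  · exact Submodule.dense_iff_topologicalClosure_eq_top.2 b.dense_span
  · rintro _ ⟨i, rfl⟩
    exact h i

omit [CompleteSpace H] in
theorem HilbertBasis.clm_ext_inner {ι : Type*} (b : HilbertBasis ι ℂ H) {S T : H →L[ℂ] H}
    (h : ∀ i k, inner ℂ (b k) (S (b i)) = inner ℂ (b k) (T (b i))) : S = T := by
  refine b.clm_ext fun i ↦ b.repr.injective ?_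
  ext k
  simpa only [b.repr_apply_apply] using h i k

theorem HilbertBasis.exists_linearIsometry {ι : Type*} (b : HilbertBasis ι ℂ H) {g : ι → H}
    (hg : Orthonormal ℂ g) : ∃ V : H →ₗᵢ[ℂ] H, ∀ i, V (b i) = g i := by
  classical
  refine ⟨hg.orthogonalFamily.linearIsometry.comp b.repr.toLinearIsometry, fun i ↦ ?_⟩
  simp [b.repr_self, OrthogonalFamily.linearIsometry_apply_single]

/-- A separable infinite-dimensional Hilbert space absorbs itself: its algebra of operators
carries an infinite amplification. -/
theorem exists_infinite_amplification [TopologicalSpace.SeparableSpace H]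
    (hH : ¬ FiniteDimensional ℂ H) :
    ∃ (s t : H →L[ℂ] H) (φ : (H →L[ℂ] H) →L[ℂ] (H →L[ℂ] H)),
      star s * s = 1 ∧ star t * t = 1 ∧ star s * t = 0 ∧ φ 1 = 1 ∧
      (∀ x y, φ (x * y) = φ x * φ y) ∧ ∀ x, φ x = s * x * star s + t * φ x * star t := by
  classical
  obtain ⟨b⟩ := exists_nat_hilbertBasis hH
  have hV : ∀ n, ∃ V : H →ₗᵢ[ℂ] H, ∀ i, V (b i) = b (Nat.pair n i) := fun n ↦
    b.exists_linearIsometry (b.orthonormal.comp (Nat.pair n) fun i j h ↦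
      (Nat.pair_eq_pair.1 h).2)
  choose V hV using hV
  obtain ⟨t, ht⟩ : ∃ t : H →ₗᵢ[ℂ] H, ∀ m, t (b m) = b (Nat.pair (m.unpair.1 + 1) m.unpair.2) :=
    b.exists_linearIsometry (b.orthonormal.comp _ fun i j h ↦ by
      have h' := Nat.pair_eq_pair.1 h
      rw [← Nat.pair_unpair i, ← Nat.pair_unpair j, Nat.succ_injective h'.1, h'.2])
  have hVb : ∀ m, b m = V m.unpair.1 (b m.unpair.2) := fun m ↦ by rw [hV, Nat.pair_unpair]
  have hext : ∀ {S T : H →L[ℂ] H}, (∀ n v, S (V n v) = T (V n v)) → S = T := fun h ↦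
    b.clm_ext fun m ↦ by rw [hVb m, h]
  have htV : ∀ n v, t (V n v) = V (n + 1) v := by
    intro n v
    have := b.clm_ext (S := (t.comp (V n)).toContinuousLinearMap)
      (T := (V (n + 1)).toContinuousLinearMap) fun i ↦ by simp [hV, ht]
    exact congrArg (fun S : H →L[ℂ] H ↦ S v) this
  have hstar : ∀ W : H →ₗᵢ[ℂ] H, star W.toContinuousLinearMap * W.toContinuousLinearMap = 1 :=
    fun W ↦ b.clm_ext_inner fun i k ↦ by
      simp [ContinuousLinearMap.star_eq_adjoint, ContinuousLinearMap.adjoint_inner_right]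
  have horth : ∀ m n, m ≠ n →
      star (V m).toContinuousLinearMap * (V n).toContinuousLinearMap = 0 :=
    fun m n hmn ↦ b.clm_ext_inner fun i k ↦ by
      have : inner ℂ (b (Nat.pair m k)) (b (Nat.pair n i)) = 0 :=
        b.orthonormal.2 fun h ↦ hmn (Nat.pair_eq_pair.1 h).1
      simp [ContinuousLinearMap.star_eq_adjoint, ContinuousLinearMap.adjoint_inner_right, hV, this]
  have hsum : IsHilbertSum ℂ (fun _ : ℕ ↦ H) V := by
    refine IsHilbertSum.mk ?_ ?_
    · intro m n hmn v w
      have := congrArg (fun S : H →L[ℂ] H ↦ inner ℂ v (S w)) (horth m n hmn)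
      simpa [ContinuousLinearMap.star_eq_adjoint, ContinuousLinearMap.adjoint_inner_right]
        using this
    · rw [← b.dense_span]
      refine Submodule.topologicalClosure_mono (Submodule.span_le.2 ?_)
      rintro _ ⟨m, rfl⟩
      rw [hVb m]
      exact Submodule.mem_iSup_of_mem m.unpair.1 ⟨_, rfl⟩
  set W := hsum.linearIsometryEquiv with hW
  have hWV : ∀ n v, W.symm (lp.single 2 n v) = V n v := fun n v ↦
    hsum.linearIsometryEquiv_symm_apply_single v
  let ψ : (H →L[ℂ] H) → (H →L[ℂ] H) := fun x ↦
    (W.symm.toContinuousLinearEquiv : lp (fun _ : ℕ ↦ H) 2 →L[ℂ] H) ∘L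
      lp.mapCLM 2 (fun _ ↦ x) (norm_nonneg x) (fun _ ↦ le_rfl) ∘L
      (W.toContinuousLinearEquiv : H →L[ℂ] lp (fun _ : ℕ ↦ H) 2)
  have hψ : ∀ x n v, ψ x (V n v) = V n (x v) := by
    intro x n v
    simp only [ψ, ContinuousLinearMap.comp_apply, ContinuousLinearEquiv.coe_coe,
      LinearIsometryEquiv.coe_toContinuousLinearEquiv, ← hWV]
    congr 1
    ext i
    rcases eq_or_ne i n with rfl | h
    · simp
    · simp [h]
  have hnorm : ∀ x, ‖ψ x‖ ≤ 1 * ‖x‖ := by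
    intro x
    rw [one_mul]
    refine ContinuousLinearMap.opNorm_le_bound _ (norm_nonneg x) fun v ↦ ?_
    simp only [ψ, ContinuousLinearMap.comp_apply, ContinuousLinearEquiv.coe_coe,
      LinearIsometryEquiv.coe_toContinuousLinearEquiv, LinearIsometryEquiv.norm_map]
    rw [← W.norm_map v]
    exact ContinuousLinearMap.le_of_opNorm_le _ (lp.norm_mapCLM_le 2 _ (norm_nonneg x) _) _
  let φ : (H →L[ℂ] H) →L[ℂ] (H →L[ℂ] H) := LinearMap.mkContinuous
    { toFun := ψ
      map_add' := fun x y ↦ hext fun n v ↦ by simp [hψ]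
      map_smul' := fun c x ↦ hext fun n v ↦ by simp [hψ] } 1 hnorm
  have hφ : ∀ x n v, φ x (V n v) = V n (x v) := hψ
  have happ : ∀ {P Q R : H →L[ℂ] H}, P * Q = R → ∀ v, P (Q v) = R v := by
    rintro P Q _ rfl v
    rfl
  have hst : star (V 0).toContinuousLinearMap * t.toContinuousLinearMap = 0 :=
    hext fun n v ↦ by
      have := happ (horth 0 (n + 1) (Nat.succ_ne_zero n).symm) v
      simpa [htV] using this
  have hts : star t.toContinuousLinearMap * (V 0).toContinuousLinearMap = 0 := by
    simpa using congrArg star hst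
  refine ⟨(V 0).toContinuousLinearMap, t.toContinuousLinearMap, φ, hstar _, hstar _, hst,
    hext fun n v ↦ by simp [hφ], fun x y ↦ hext fun n v ↦ by simp [hφ], fun x ↦ hext ?_⟩
  rintro (_ | n) v
  · have h1 := happ (hstar (V 0)) v
    have h2 := happ hts v
    simp only [LinearIsometry.coe_toContinuousLinearMap] at h1 h2
    simp [hφ, h1, h2]
  · have h1 := happ (horth 0 (n + 1) (Nat.succ_ne_zero n).symm) v
    have h2 := happ (hstar t) (V n v)
    simp only [LinearIsometry.coe_toContinuousLinearMap, htV] at h1 h2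
    simp [hφ, h1, h2, htV]

theorem exists_orthonormal_seq_with_room (hH : ¬ FiniteDimensional ℂ H) (T : ℕ → H →L[ℂ] H) :
    ∃ g : ℕ → H, Orthonormal ℂ g ∧
      ∀ j m n, m ≠ n → j ≤ m → j ≤ n → inner ℂ (g m) (T j (g n)) = 0 := by
  have hstep : ∀ s : Finset (ℕ × H), (∀ x ∈ s, ‖x.2‖ = 1) → ∃ y : ℕ × H, ‖y.2‖ = 1 ∧
      ∀ x ∈ s, x.1 < y.1 ∧ inner ℂ x.2 y.2 = 0 ∧ ∀ j ≤ y.1, inner ℂ (T j x.2) y.2 = 0 ∧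
        inner ℂ (star (T j) x.2) y.2 = 0 := by
    intro s _
    set k := s.sup Prod.fst + 1 with hk
    have hfin : ((Prod.snd '' (s : Set (ℕ × H))) ∪
        ⋃ j ∈ Set.Iic k, (((fun x : ℕ × H ↦ T j x.2) '' (s : Set (ℕ × H))) ∪
          ((fun x : ℕ × H ↦ star (T j) x.2) '' (s : Set (ℕ × H))))).Finite :=
      (s.finite_toSet.image _).union ((Set.finite_Iic k).biUnion fun j _ ↦
        (s.finite_toSet.image _).union (s.finite_toSet.image _))
    obtain ⟨v, hv1, hv⟩ := exists_orthogonal_unit_vector hH hfin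
    refine ⟨(k, v), hv1, fun x hx ↦ ⟨Nat.lt_succ_of_le (Finset.le_sup (f := Prod.fst) hx),
      hv _ (Or.inl ⟨x, hx, rfl⟩), fun j hj ↦ ⟨hv _ (Or.inr ?_), hv _ (Or.inr ?_)⟩⟩⟩
    · exact Set.mem_biUnion (show j ∈ Set.Iic k from hj) (Or.inl ⟨x, hx, rfl⟩)
    · exact Set.mem_biUnion (show j ∈ Set.Iic k from hj) (Or.inr ⟨x, hx, rfl⟩)
  obtain ⟨f, hf1, hf⟩ := exists_seq_of_forall_finset_exists (α := ℕ × H) (fun x ↦ ‖x.2‖ = 1)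
    (fun x y ↦ x.1 < y.1 ∧ inner ℂ x.2 y.2 = 0 ∧ ∀ j ≤ y.1, inner ℂ (T j x.2) y.2 = 0 ∧
      inner ℂ (star (T j) x.2) y.2 = 0) hstep
  have hmono : StrictMono fun n ↦ (f n).1 := fun m n h ↦ (hf m n h).1
  refine ⟨fun n ↦ (f n).2, ⟨hf1, fun m n hmn ↦ ?_⟩, fun j m n hmn hm hn ↦ ?_⟩
  · rcases lt_or_gt_of_ne hmn with h | h
    · exact (hf m n h).2.1
    · exact inner_eq_zero_symm.1 (hf n m h).2.1
  · rcases lt_or_gt_of_ne hmn with h | h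
    · have := ((hf m n h).2.2 j (hn.trans (hmono.id_le n))).2
      rwa [ContinuousLinearMap.star_eq_adjoint, ContinuousLinearMap.adjoint_inner_left] at this
    · exact inner_eq_zero_symm.1 ((hf n m h).2.2 j (hm.trans (hmono.id_le m))).1

/-- Room for countably many operators: two sequences of isometries with orthogonal ranges such
that the first `N` operators map the ranges of the `N`-th ones into orthogonal positions. -/
theorem exists_isometries_with_room [TopologicalSpace.SeparableSpace H]
    (hH : ¬ FiniteDimensional ℂ H) (T : ℕ → H →L[ℂ] H) :
    ∃ α γ : ℕ → H →L[ℂ] H, (∀ m n, star (α m) * α n = if m = n then 1 else 0) ∧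
      (∀ m n, star (γ m) * γ n = if m = n then 1 else 0) ∧ (∀ m n, star (γ m) * α n = 0) ∧
      ∀ j m n, j ≤ m → j ≤ n → star (γ m) * T j * α n = 0 := by
  obtain ⟨b⟩ := exists_nat_hilbertBasis hH
  obtain ⟨g, horth, hT⟩ := exists_orthonormal_seq_with_room hH T
  have hα : ∀ n, ∃ V : H →ₗᵢ[ℂ] H, ∀ i, V (b i) = g (2 * Nat.pair n i) := fun n ↦
    b.exists_linearIsometry (horth.comp _ fun i j h ↦
      (Nat.pair_eq_pair.1 (by simpa using h : Nat.pair n i = Nat.pair n j)).2)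
  have hγ : ∀ n, ∃ V : H →ₗᵢ[ℂ] H, ∀ i, V (b i) = g (2 * Nat.pair n i + 1) := fun n ↦
    b.exists_linearIsometry (horth.comp _ fun i j h ↦
      (Nat.pair_eq_pair.1 (by simpa using h : Nat.pair n i = Nat.pair n j)).2)
  choose α hα using hα
  choose γ hγ using hγ
  have hone : ∀ i k, inner ℂ (g i) (g k) = if i = k then 1 else 0 := orthonormal_iff_ite.1 horth
  have hb : ∀ i k, inner ℂ (b i) (b k) = if i = k then (1 : ℂ) else 0 :=
    orthonormal_iff_ite.1 b.orthonormal
  refine ⟨fun n ↦ (α n).toContinuousLinearMap, fun n ↦ (γ n).toContinuousLinearMap,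
    fun m n ↦ b.clm_ext_inner fun i k ↦ ?_, fun m n ↦ b.clm_ext_inner fun i k ↦ ?_,
    fun m n ↦ b.clm_ext_inner fun i k ↦ ?_, fun j m n hm hn ↦ b.clm_ext_inner fun i k ↦ ?_⟩
  · by_cases h : m = n <;>
      simp [ContinuousLinearMap.star_eq_adjoint, ContinuousLinearMap.adjoint_inner_right, hα,
        hone, hb, h]
  · by_cases h : m = n <;>
      simp [ContinuousLinearMap.star_eq_adjoint, ContinuousLinearMap.adjoint_inner_right, hγ,
        hone, hb, h]
  · simp only [mul_apply_eq_comp, ContinuousLinearMap.star_eq_adjoint,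
      ContinuousLinearMap.adjoint_inner_right, LinearIsometry.coe_toContinuousLinearMap, hα, hγ,
      hone, zero_apply, inner_zero_right]
    exact if_neg (by omega)
  · simp only [mul_apply_eq_comp, ContinuousLinearMap.star_eq_adjoint,
      ContinuousLinearMap.adjoint_inner_right, LinearIsometry.coe_toContinuousLinearMap, hα, hγ,
      zero_apply, inner_zero_right]
    have h1 := Nat.left_le_pair m k
    have h2 := Nat.left_le_pair n i
    exact hT j _ _ (by omega) (by omega) (by omega)

end HilbertSpace

section Corners

variable {X H K : Type*} [TopologicalSpace X] [SecondCountableTopology X] [LocallyCompactSpace X]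
  [T2Space X] [NormedAddCommGroup H] [InnerProductSpace ℂ H] [CompleteSpace H]
  [TopologicalSpace K] [CompactSpace K]

open BoundedContinuousFunction

omit [LocallyCompactSpace X] [T2Space X] [CompleteSpace H] in
theorem ContinuousMap.exists_seq_dist_lt {E : Type*} [NormedAddCommGroup E]
    (f : C(K, X →ᵇ E)) {ε : ℝ} (hε : 0 < ε) :
    ∃ T : ℕ → E, ∀ k x, ∃ j, ‖f k x - T j‖ < ε := by
  have hs : TopologicalSpace.IsSeparable
      ((fun p : (X →ᵇ E) × X ↦ p.1 p.2) '' (Set.range f ×ˢ Set.univ)) :=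
    ((isCompact_range f.continuous).isSeparable.prod
      (TopologicalSpace.isSeparable_univ_iff.2 inferInstance)).image
      continuous_eval
  obtain ⟨c, hc, hsc⟩ := hs
  obtain ⟨T, hT⟩ := (hc.insert 0).exists_eq_range (Set.insert_nonempty 0 c)
  refine ⟨T, fun k x ↦ ?_⟩
  obtain ⟨y, hy, hd⟩ := Metric.mem_closure_iff.1 (hsc ⟨(f k, x), ⟨⟨k, rfl⟩, trivial⟩, rfl⟩) ε hε
  obtain ⟨j, rfl⟩ : y ∈ Set.range T := hT ▸ Set.mem_insert_of_mem _ hy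
  exact ⟨j, by simpa [dist_eq_norm] using hd⟩

omit [SecondCountableTopology X] [LocallyCompactSpace X] [T2Space X] in
theorem ContinuousMap.isOpen_forall_exists_dist_lt {E : Type*} [NormedAddCommGroup E]
    (f : C(K, X →ᵇ E)) (T : ℕ → E) (ε : ℝ) (N : ℕ) :
    IsOpen {x : X | ∀ k, ∃ j ≤ N, ‖f k x - T j‖ < ε} := by
  have hf : Continuous fun p : X × K ↦ f p.2 p.1 := by fun_prop
  rw [isOpen_iff_mem_nhds]
  intro x hx
  have := isCompact_univ.eventually_forall_of_forall_eventually (x₀ := x) (K := (Set.univ : Set K))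
    (P := fun x k ↦ ∃ j ≤ N, ‖f k x - T j‖ < ε) fun k _ ↦ by
      obtain ⟨j, hj, h⟩ := hx k
      have ho : IsOpen {p : X × K | ‖f p.2 p.1 - T j‖ < ε} :=
        isOpen_lt (by fun_prop) continuous_const
      filter_upwards [ho.mem_nhds h] with p hp using ⟨j, hj, hp⟩
  filter_upwards [this] with x hx k using hx k trivial

omit [SecondCountableTopology X] [LocallyCompactSpace X] [T2Space X] in
theorem ContinuousMap.exists_forall_exists_dist_lt {E : Type*} [NormedAddCommGroup E]
    (f : C(K, X →ᵇ E)) {T : ℕ → E} {ε : ℝ} (hT : ∀ k x, ∃ j, ‖f k x - T j‖ < ε) (x : X) :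
    ∃ N, ∀ k, ∃ j ≤ N, ‖f k x - T j‖ < ε := by
  obtain ⟨N, hN⟩ := isCompact_univ.elim_directed_cover
    (fun N : ℕ ↦ {k : K | ∃ j ≤ N, ‖f k x - T j‖ < ε}) (fun N ↦ by
      have : {k : K | ∃ j ≤ N, ‖f k x - T j‖ < ε} = ⋃ j ≤ N, {k : K | ‖f k x - T j‖ < ε} := by
        ext; simp
      rw [this]
      exact isOpen_biUnion fun j _ ↦ isOpen_lt (by fun_prop) continuous_const)
    (fun k _ ↦ by
      obtain ⟨j, hj⟩ := hT k x
      exact Set.mem_iUnion.2 ⟨j, j, le_rfl, hj⟩)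
    (Monotone.directed_le fun M N h k ⟨j, hj, hk⟩ ↦ ⟨j, hj.trans h, hk⟩)
  exact ⟨N, fun k ↦ hN (Set.mem_univ k)⟩

omit [SecondCountableTopology X] [LocallyCompactSpace X] [T2Space X] [CompactSpace K]
  [TopologicalSpace K] in
theorem PartitionOfUnity.star_finsum_mul_finsum (φ : PartitionOfUnity ℕ X) (x : X)
    (g h : ℕ → H →L[ℂ] H) (S : H →L[ℂ] H) :
    star (∑ᶠ n, √(φ n x) • g n) * S * (∑ᶠ n, √(φ n x) • h n) =
      ∑ m ∈ φ.finsupport x, ∑ n ∈ φ.finsupport x,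
        (√(φ m x) * √(φ n x)) • (star (g m) * S * h n) := by
  have hsum : ∀ g : ℕ → H →L[ℂ] H, ∑ᶠ n, √(φ n x) • g n =
      ∑ n ∈ φ.finsupport x, √(φ n x) • g n := by
    intro g
    refine finsum_eq_sum_of_support_subset _ fun n hn ↦ ?_
    rw [φ.coe_finsupport]
    intro h0
    simp [show φ n x = 0 from h0] at hn
  rw [hsum, hsum, star_sum, Finset.sum_mul, Finset.sum_mul]
  refine Finset.sum_congr rfl fun m _ ↦ ?_
  rw [Finset.mul_sum]
  refine Finset.sum_congr rfl fun n _ ↦ ?_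
  rw [star_smul, star_trivial, smul_mul_assoc, smul_mul_assoc, mul_smul_comm, smul_smul]

theorem exists_isometries_norm_corner_le [TopologicalSpace.SeparableSpace H]
    (hH : ¬ FiniteDimensional ℂ H) (f : C(K, X →ᵇ (H →L[ℂ] H))) {ε : ℝ} (hε : 0 < ε) :
    ∃ a c : X →ᵇ (H →L[ℂ] H), star a * a = 1 ∧ star c * c = 1 ∧ star c * a = 0 ∧
      ∀ k, ‖star c * f k * a‖ ≤ ε := by
  obtain ⟨T, hT⟩ := f.exists_seq_dist_lt hε
  obtain ⟨α, γ, hα, hγ, hγα, hroom⟩ := exists_isometries_with_room hH T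
  obtain ⟨φ, hφ⟩ := PartitionOfUnity.exists_isSubordinate (isClosed_univ (X := X))
    (fun N : ℕ ↦ {x : X | ∀ k, ∃ j ≤ N, ‖f k x - T j‖ < ε})
    (f.isOpen_forall_exists_dist_lt T ε)
    (fun x _ ↦ Set.mem_iUnion.2 (f.exists_forall_exists_dist_lt hT x))
  have hnorm : ∀ a : H →L[ℂ] H, star a * a = 1 → ‖a‖ ≤ 1 := by
    intro a ha
    have h1 : ‖a‖ * ‖a‖ ≤ 1 := by
      rw [← CStarRing.norm_star_mul_self, ha]
      exact ContinuousLinearMap.norm_id_le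
    nlinarith [norm_nonneg a]
  have hcont : ∀ g : ℕ → H →L[ℂ] H, Continuous fun x ↦ ∑ᶠ n, √(φ n x) • g n := by
    intro g
    refine continuous_finsum (fun n ↦ by fun_prop) (φ.locallyFinite.subset fun n x hx h0 ↦ ?_)
    simp [show φ n x = 0 from h0] at hx
  have hone : ∀ g : ℕ → H →L[ℂ] H, (∀ m n, star (g m) * g n = if m = n then 1 else 0) →
      ∀ x, star (∑ᶠ n, √(φ n x) • g n) * (∑ᶠ n, √(φ n x) • g n) = 1 := by
    intro g hg x
    have := φ.star_finsum_mul_finsum x g g 1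
    rw [mul_one] at this
    rw [this]
    calc _ = ∑ m ∈ φ.finsupport x, φ m x • (1 : H →L[ℂ] H) := by
          refine Finset.sum_congr rfl fun m hm ↦ ?_
          rw [Finset.sum_eq_single_of_mem m hm fun n _ hn ↦ by simp [hg, hn.symm]]
          simp [hg, Real.mul_self_sqrt (φ.nonneg m x)]
      _ = 1 := by rw [← Finset.sum_smul, φ.sum_finsupport (Set.mem_univ x), one_smul]
  have hzero : ∀ x, star (∑ᶠ n, √(φ n x) • γ n) * (∑ᶠ n, √(φ n x) • α n) = 0 := by
    intro x
    have := φ.star_finsum_mul_finsum x γ α 1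
    simpa [hγα] using this
  refine ⟨.ofNormedAddCommGroup _ (hcont α) 1 fun x ↦ hnorm _ (hone α hα x),
    .ofNormedAddCommGroup _ (hcont γ) 1 fun x ↦ hnorm _ (hone γ hγ x), ?_, ?_, ?_, fun k ↦ ?_⟩
  · exact BoundedContinuousFunction.ext (hone α hα)
  · exact BoundedContinuousFunction.ext (hone γ hγ)
  · exact BoundedContinuousFunction.ext hzero
  · rw [BoundedContinuousFunction.norm_le hε.le]
    intro x
    change ‖star (∑ᶠ n, √(φ n x) • γ n) * f k x * (∑ᶠ n, √(φ n x) • α n)‖ ≤ ε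
    classical
    have hex : ∃ N, φ N x ≠ 0 := (φ.exists_pos (Set.mem_univ x)).imp fun _ h ↦ h.ne'
    obtain ⟨j, hj, hd⟩ := hφ (Nat.find hex) (subset_tsupport _ (Nat.find_spec hex)) k
    have hle : ∀ n ∈ φ.finsupport x, j ≤ n := fun n hn ↦
      hj.trans (Nat.find_le ((φ.mem_finsupport x).1 hn))
    have h0 : star (∑ᶠ n, √(φ n x) • γ n) * T j * (∑ᶠ n, √(φ n x) • α n) = 0 := by
      rw [φ.star_finsum_mul_finsum x γ α (T j)]
      refine Finset.sum_eq_zero fun m hm ↦ Finset.sum_eq_zero fun n hn ↦ ?_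
      rw [hroom j m n (hle m hm) (hle n hn), smul_zero]
    have h1 := hnorm _ (hone α hα x)
    have h2 := hnorm _ (hone γ hγ x)
    rw [← norm_star] at h2
    rw [← sub_zero (_ * _ * _), ← h0, ← sub_mul, ← mul_sub]
    refine (norm_mul_le _ _).trans ((mul_le_mul_of_nonneg_left h1 (norm_nonneg _)).trans ?_)
    rw [mul_one]
    refine (norm_mul_le _ _).trans ((mul_le_mul_of_nonneg_right h2 (norm_nonneg _)).trans ?_)
    rw [one_mul]
    exact hd.le

end Corners

section Nullhomotopy

variable {X H K : Type*} [TopologicalSpace X] [SecondCountableTopology X] [LocallyCompactSpace X]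
  [T2Space X] [NormedAddCommGroup H] [InnerProductSpace ℂ H] [CompleteSpace H]
  [TopologicalSpace.SeparableSpace H] [TopologicalSpace K] [CompactSpace K]

open BoundedContinuousFunction

theorem UnitJoined.exists_of_norm_sub_lt {R : Type*} [NormedRing R] [NormedAlgebra ℝ R]
    [HasSummableGeomSeries R] {u : R} (hu : IsUnit u) :
    ∃ ε > 0, ∀ v, ‖v - u‖ < ε → UnitJoined u v := by
  obtain ⟨ε, hε, hball⟩ := Metric.isOpen_iff.1 (Units.isOpen (R := R)) u hu
  refine ⟨ε, hε, fun v hv ↦ ?_⟩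
  have hc : IsPathConnected (Metric.ball u ε) :=
    (convex_ball u ε).isPathConnected ⟨u, Metric.mem_ball_self hε⟩
  exact (hc.joinedIn u (Metric.mem_ball_self hε) v (mem_ball_iff_norm.2 hv)).mono hball

/-- A unit with arbitrarily small transverse corners in a normed ring with an infinite
amplification is in the identity component. -/
theorem UnitJoined.one_of_small_corners {R : Type*} [NormedRing R] [NormedAlgebra ℝ R]
    [HasSummableGeomSeries R] {s s' t t' : R} (hs : s' * s = 1) (ht : t' * t = 1)
    (hst : s' * t = 0) (hts : t' * s = 0) (φ : R →* R)
    (hφ : ∀ x, φ x = s * x * s' + t * φ x * t') {u : R} (hu : IsUnit u)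
    (h : ∀ ε > 0, ∃ a b c d, b * a = 1 ∧ d * c = 1 ∧ d * a = 0 ∧ ‖c * (d * u * a) * b‖ < ε) :
    UnitJoined u 1 := by
  obtain ⟨ε, hε, hnear⟩ := UnitJoined.exists_of_norm_sub_lt hu
  obtain ⟨a, b, c, d, hba, hdc, hda, hlt⟩ := h ε hε
  have hv : UnitJoined u (u - c * (d * u * a) * b) := hnear _ (by simpa using hlt)
  refine hv.trans (UnitJoined.one_of_room hs ht hst hts φ hφ hv.isUnit_right hba hdc hda ?_)
  have : d * (u - c * (d * u * a) * b) * a = d * u * a - (d * c) * (d * u * a) * (b * a) := by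
    noncomm_ring
  rw [this, hdc, hba, one_mul, mul_one, sub_self]

theorem unitJoined_one_of_compact (hH : ¬ FiniteDimensional ℂ H)
    {f : C(K, X →ᵇ (H →L[ℂ] H))} (hf : IsUnit f) : UnitJoined f 1 := by
  obtain ⟨s, t, φ, hs, ht, hst, hφ1, hφm, hφ⟩ := exists_infinite_amplification hH
  have hts : star t * s = 0 := by simpa using congrArg star hst
  let κ : (H →L[ℂ] H) → C(K, X →ᵇ (H →L[ℂ] H)) := fun x ↦
    ContinuousMap.const K (BoundedContinuousFunction.const X x)
  let Φ : C(K, X →ᵇ (H →L[ℂ] H)) →* C(K, X →ᵇ (H →L[ℂ] H)) :=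
    { toFun := fun g ↦ ⟨fun k ↦ φ.compLeftContinuousBounded X (g k), by fun_prop⟩
      map_one' := ContinuousMap.ext fun k ↦ BoundedContinuousFunction.ext fun x ↦ hφ1
      map_mul' := fun g h ↦ ContinuousMap.ext fun k ↦ BoundedContinuousFunction.ext fun x ↦
        hφm _ _ }
  have hnorm : ∀ a : X →ᵇ (H →L[ℂ] H), star a * a = 1 → ‖a‖ ≤ 1 := by
    intro a ha
    have h1 : ‖a‖ * ‖a‖ ≤ 1 := by
      rw [← CStarRing.norm_star_mul_self, ha]
      exact (BoundedContinuousFunction.norm_le zero_le_one).2 fun x ↦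
        ContinuousLinearMap.norm_id_le
    nlinarith [norm_nonneg a]
  refine UnitJoined.one_of_small_corners (R := C(K, X →ᵇ (H →L[ℂ] H))) (s := κ s)
    (s' := κ (star s)) (t := κ t) (t' := κ (star t)) ?_ ?_ ?_ ?_ Φ ?_ hf fun ε hε ↦ ?_
  · exact ContinuousMap.ext fun k ↦ BoundedContinuousFunction.ext fun x ↦ hs
  · exact ContinuousMap.ext fun k ↦ BoundedContinuousFunction.ext fun x ↦ ht
  · exact ContinuousMap.ext fun k ↦ BoundedContinuousFunction.ext fun x ↦ hst
  · exact ContinuousMap.ext fun k ↦ BoundedContinuousFunction.ext fun x ↦ hts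
  · exact fun g ↦ ContinuousMap.ext fun k ↦ BoundedContinuousFunction.ext fun x ↦ hφ _
  · obtain ⟨a, c, ha, hc, hca, hfa⟩ := exists_isometries_norm_corner_le hH f (half_pos hε)
    refine ⟨.const K a, .const K (star a), .const K c, .const K (star c),
      ContinuousMap.ext fun k ↦ ha, ContinuousMap.ext fun k ↦ hc, ContinuousMap.ext fun k ↦ hca,
      lt_of_le_of_lt ((ContinuousMap.norm_le _ (half_pos hε).le).2 fun k ↦ ?_)
      (half_lt_self hε)⟩
    change ‖c * (star c * f k * a) * star a‖ ≤ ε / 2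
    have h1 := hnorm a ha
    have h2 := hnorm c hc
    rw [← norm_star] at h1
    refine (norm_mul_le _ _).trans ((mul_le_mul_of_nonneg_left h1 (norm_nonneg _)).trans ?_)
    rw [mul_one]
    refine (norm_mul_le _ _).trans ((mul_le_mul_of_nonneg_right h2 (norm_nonneg _)).trans ?_)
    rw [one_mul]
    exact hfa k

/-- Compact families of invertible elements of `C_b(X, B(H))` are null-homotopic. -/
theorem exists_nullhomotopy_isUnit (hH : ¬ FiniteDimensional ℂ H)
    (f : C(K, X →ᵇ (H →L[ℂ] H))) (hf : ∀ k, IsUnit (f k)) :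
    ∃ h : C(unitInterval × K, X →ᵇ (H →L[ℂ] H)), (∀ k, h (0, k) = f k) ∧ (∀ k, h (1, k) = 1) ∧
      ∀ p, IsUnit (h p) := by
  obtain ⟨γ, hγ⟩ := unitJoined_one_of_compact hH (ContinuousMap.isUnit_iff_forall_isUnit f |>.2 hf)
  refine ⟨⟨fun p ↦ γ p.1 p.2, by fun_prop⟩, fun k ↦ by simp, fun k ↦ by simp, fun p ↦ ?_⟩
  exact ContinuousMap.isUnit_iff_forall_isUnit _ |>.1 (hγ p.1) p.2

end Nullhomotopy

section Cube

variable {ι : Type*}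

/-- The face of the cube `[0, 1]^ι` spanned by the finite set `σ` of coordinates. -/
def cubeFace (σ : Finset ι) : Set (ι → ℝ) :=
  {w | (∀ i, w i ∈ Set.Icc (0 : ℝ) 1) ∧ ∀ i ∉ σ, w i = 0}

/-- The boundary of a face of the cube. -/
def cubeFaceBoundary (σ : Finset ι) : Set (ι → ℝ) :=
  {w ∈ cubeFace σ | ∃ i ∈ σ, w i = 0 ∨ w i = 1}

theorem cubeFace_mono {σ τ : Finset ι} (h : σ ⊆ τ) : cubeFace σ ⊆ cubeFace τ :=
  fun _ hw ↦ ⟨hw.1, fun i hi ↦ hw.2 i fun hi' ↦ hi (h hi')⟩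

theorem isClosed_cubeFace (σ : Finset ι) : IsClosed (cubeFace σ) := by
  have : cubeFace σ = (⋂ i, (fun w : ι → ℝ ↦ w i) ⁻¹' Set.Icc 0 1) ∩
      ⋂ i ∈ {i | i ∉ σ}, (fun w : ι → ℝ ↦ w i) ⁻¹' {0} := by
    ext w
    simp [cubeFace]
  rw [this]
  exact (isClosed_iInter fun i ↦ isClosed_Icc.preimage (continuous_apply i)).inter
    (isClosed_biInter fun i _ ↦ isClosed_singleton.preimage (continuous_apply i))

theorem isCompact_cubeFace (σ : Finset ι) : IsCompact (cubeFace σ) :=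
  (isCompact_univ_pi fun _ ↦ isCompact_Icc).of_isClosed_subset (isClosed_cubeFace σ)
    fun _ hw i _ ↦ hw.1 i

theorem isClosed_exists_mem_eq (σ : Finset ι) (a : ℝ) :
    IsClosed {w : ι → ℝ | ∃ i ∈ σ, w i = a} := by
  have : {w : ι → ℝ | ∃ i ∈ σ, w i = a} = ⋃ i ∈ σ, (fun w : ι → ℝ ↦ w i) ⁻¹' {a} := by
    ext w
    simp
  rw [this]
  exact σ.finite_toSet.isClosed_biUnion fun i _ ↦
    isClosed_singleton.preimage (continuous_apply i)

theorem isCompact_cubeFaceBoundary (σ : Finset ι) : IsCompact (cubeFaceBoundary σ) := by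
  have : cubeFaceBoundary σ = cubeFace σ ∩
      ({w | ∃ i ∈ σ, w i = 0} ∪ {w | ∃ i ∈ σ, w i = 1}) := by
    ext w
    simp only [cubeFaceBoundary, Set.mem_ofPred_eq, Set.mem_inter_iff, Set.mem_union, and_or_left,
      exists_or]
  rw [this]
  exact (isCompact_cubeFace σ).inter_right
    ((isClosed_exists_mem_eq σ 0).union (isClosed_exists_mem_eq σ 1))

/-- A null-homotopic map on the boundary of a face extends over the face. -/
theorem exists_extension_cubeFace {E : Type*} [TopologicalSpace E] {σ : Finset ι}
    (hσ : σ.Nonempty) {g₀ : E} (h : C(unitInterval × cubeFaceBoundary σ, E))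
    (h1 : ∀ k, h (1, k) = g₀) :
    ∃ F : C(cubeFace σ, E), (∀ w, F w ∈ Set.range h) ∧
      ∀ k : cubeFaceBoundary σ, F ⟨k, k.2.1⟩ = h (0, k) := by
  classical
  have : CompactSpace (cubeFaceBoundary σ) :=
    isCompact_iff_compactSpace.1 (isCompact_cubeFaceBoundary σ)
  let c : ι → ℝ := fun i ↦ if i ∈ σ then 1 / 2 else 0
  have hcσ : ∀ i ∈ σ, c i = 1 / 2 := fun i hi ↦ if_pos hi
  have hcσ' : ∀ i ∉ σ, c i = 0 := fun i hi ↦ if_neg hi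
  have habs : ∀ w ∈ cubeFace σ, ∀ i, |w i - c i| ≤ 1 / 2 := by
    intro w hw i
    by_cases hi : i ∈ σ
    · rw [hcσ i hi, abs_le]
      constructor <;> linarith [(hw.1 i).1, (hw.1 i).2]
    · rw [hcσ' i hi, hw.2 i hi]
      norm_num
  have hmem : ∀ w : ι → ℝ, (∀ i ∈ σ, |w i - c i| ≤ 1 / 2) → (∀ i ∉ σ, w i = 0) →
      w ∈ cubeFace σ := by
    refine fun w hw hw' ↦ ⟨fun i ↦ ?_, hw'⟩
    by_cases hi : i ∈ σ
    · have := hw i hi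
      rw [hcσ i hi, abs_le] at this
      constructor <;> linarith [this.1, this.2]
    · simp [hw' i hi]
  let q : unitInterval × cubeFaceBoundary σ → cubeFace σ := fun p ↦
    ⟨fun i ↦ c i + (1 - (p.1 : ℝ)) * (p.2.1 i - c i), by
      refine hmem _ (fun i _ ↦ ?_) fun i hi ↦ by simp [hcσ' i hi, p.2.2.1.2 i hi]
      rw [add_sub_cancel_left, abs_mul, abs_of_nonneg (by linarith [p.1.2.2])]
      have := habs _ p.2.2.1 i
      nlinarith [p.1.2.1, p.1.2.2, abs_nonneg (p.2.1 i - c i)]⟩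
  have hq : Continuous q := by
    refine Continuous.subtype_mk (continuous_pi fun i ↦ ?_) _
    have : Continuous fun p : unitInterval × cubeFaceBoundary σ ↦ p.2.1 i :=
      (continuous_apply i).comp (continuous_subtype_val.comp continuous_snd)
    fun_prop
  have hle : ∀ t k t' k', q (t, k) = q (t', k') → (t' : ℝ) ≤ t := by
    intro t k t' k' heq
    obtain ⟨i, hi, hk⟩ := k.2.2
    have hk' : |k.1 i - c i| = 1 / 2 := by
      rw [hcσ i hi]
      rcases hk with hk | hk <;> rw [hk] <;> norm_num [abs_of_pos]
    have hi' : (1 - (t : ℝ)) * (k.1 i - c i) = (1 - (t' : ℝ)) * (k'.1 i - c i) := by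
      have := congrFun (congrArg Subtype.val heq) i
      exact add_left_cancel this
    have h2 := congrArg abs hi'
    rw [abs_mul, abs_mul, hk', abs_of_nonneg (by linarith [t.2.2]),
      abs_of_nonneg (by linarith [t'.2.2])] at h2
    have := habs _ k'.2.1 i
    nlinarith [t'.2.2]
  have hfib : ∀ p p', q p = q p' → h p = h p' := by
    rintro ⟨t, k⟩ ⟨t', k'⟩ heq
    obtain rfl : t = t' := Subtype.ext (le_antisymm (hle _ _ _ _ heq.symm) (hle _ _ _ _ heq))
    rcases eq_or_ne t 1 with rfl | ht
    · rw [h1, h1]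
    · have ht' : (1 : ℝ) - t ≠ 0 := fun h0 ↦
        ht (Subtype.ext (by simpa using (sub_eq_zero.1 h0).symm))
      obtain rfl : k = k' := Subtype.ext <| funext fun i ↦ by
        have : (1 - (t : ℝ)) * (k.1 i - c i) = (1 - (t : ℝ)) * (k'.1 i - c i) :=
          add_left_cancel (congrFun (congrArg Subtype.val heq) i)
        exact sub_left_injective (mul_left_cancel₀ ht' this)
      rfl
  have hsurj : Function.Surjective q := by
    rintro ⟨w, hw⟩
    obtain ⟨i, hi, hmax⟩ := σ.exists_max_image (fun i ↦ |w i - c i|) hσ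
    rcases (abs_nonneg (w i - c i)).eq_or_lt with h0 | hpos
    · have hwc : ∀ k, w k = c k := by
        intro k
        by_cases hk : k ∈ σ
        · have := hmax k hk
          rw [← h0] at this
          exact sub_eq_zero.1 (abs_eq_zero.1 (le_antisymm this (abs_nonneg _)))
        · rw [hcσ' k hk, hw.2 k hk]
      refine ⟨(1, ⟨fun k ↦ if k ∈ σ then 1 else 0, hmem _ (fun k hk ↦ ?_) fun k hk ↦ if_neg hk,
        i, hi, Or.inr (if_pos hi)⟩), Subtype.ext (funext fun k ↦ ?_)⟩
      · rw [hcσ k hk, if_pos hk]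
        norm_num [abs_of_pos]
      · simp [q, hwc]
    · have hr := habs w hw i
      set r := |w i - c i| with hrdef
      have hk : ∀ k, c k + (w k - c k) / (2 * r) - c k = (w k - c k) / (2 * r) := fun k ↦ by ring
      refine ⟨(⟨1 - 2 * r, by linarith, by linarith⟩,
        ⟨fun k ↦ c k + (w k - c k) / (2 * r), hmem _ (fun k hk' ↦ ?_) fun k hk' ↦ ?_, i, hi, ?_⟩),
        Subtype.ext (funext fun k ↦ ?_)⟩
      · rw [hk, abs_div, abs_of_pos (by linarith : 0 < 2 * r), div_le_iff₀ (by linarith)]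
        linarith [hmax k hk']
      · simp [hcσ' k hk', hw.2 k hk']
      · beta_reduce
        rw [hcσ i hi] at hrdef ⊢
        rcases abs_cases (w i - 1 / 2) with ⟨h2, -⟩ | ⟨h2, -⟩
        · right
          rw [← h2, ← hrdef]
          field_simp
          norm_num
        · left
          rw [← neg_eq_iff_eq_neg.2 h2, ← hrdef]
          field_simp
          norm_num
      · simp only [q]
        field_simp
        ring
  have hquot : IsQuotientMap q := hq.isClosedMap.isQuotientMap hq hsurj
  have hF : ∀ p, h (Function.surjInv hsurj (q p)) = h p := fun p ↦
    hfib _ _ (Function.surjInv_eq hsurj (q p))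
  refine ⟨⟨fun w ↦ h (Function.surjInv hsurj w), hquot.continuous_iff.2 ?_⟩,
    fun w ↦ ⟨_, rfl⟩, fun k ↦ ?_⟩
  · exact h.continuous.congr fun p ↦ (hF p).symm
  · have : (⟨k, k.2.1⟩ : cubeFace σ) = q (0, k) := Subtype.ext (funext fun i ↦ by simp [q])
    change h (Function.surjInv hsurj _) = _
    rw [this, hF]

end Cube

section Filling

variable {ι E : Type*} [NormedAddCommGroup E] [NormedSpace ℝ E]

/-- The weighted mean of the points `j i` with finitely supported weights `w i`. -/
noncomputable def weightedMean (j : ι → E) (w : ι → ℝ) : E :=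
  (∑ᶠ i, w i)⁻¹ • ∑ᶠ i, w i • j i

theorem weightedMean_eq_centerMass (j : ι → E) {σ : Finset ι} {w : ι → ℝ} (hw : w ∈ cubeFace σ) :
    weightedMean j w = σ.centerMass w j := by
  have h : Function.support w ⊆ σ := fun i hi ↦ by
    by_contra hiσ
    exact hi (hw.2 i hiσ)
  rw [weightedMean, finsum_eq_sum_of_support_subset w h,
    finsum_eq_sum_of_support_subset (fun i ↦ w i • j i)
      ((Function.support_smul_subset_left w j).trans h)]
  rfl

theorem sum_pos_of_mem_cubeFace {σ : Finset ι} {w : ι → ℝ} (hw : w ∈ cubeFace σ)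
    (h1 : ∃ i, w i = 1) : 0 < ∑ i ∈ σ, w i := by
  obtain ⟨i, hi⟩ := h1
  have hiσ : i ∈ σ := by
    by_contra h
    rw [hw.2 i h] at hi
    exact zero_ne_one hi
  exact Finset.sum_pos' (fun k _ ↦ (hw.1 k).1) ⟨i, hiσ, by rw [hi]; exact one_pos⟩

theorem weightedMean_mem_convexHull (j : ι → E) {σ : Finset ι} {w : ι → ℝ} (hw : w ∈ cubeFace σ)
    (h1 : ∃ i, w i = 1) : weightedMean j w ∈ convexHull ℝ (j '' σ) := by
  rw [weightedMean_eq_centerMass j hw]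
  exact (convex_convexHull ℝ _).centerMass_mem (fun i _ ↦ (hw.1 i).1)
    (sum_pos_of_mem_cubeFace hw h1) fun i hi ↦ subset_convexHull ℝ _ ⟨i, hi, rfl⟩

theorem continuousOn_weightedMean (j : ι → E) (σ : Finset ι) :
    ContinuousOn (weightedMean j) {w ∈ cubeFace σ | ∃ i, w i = 1} := by
  refine ContinuousOn.congr (f := fun w ↦ σ.centerMass w j) ?_ fun w hw ↦
    weightedMean_eq_centerMass j hw.1
  refine ContinuousOn.smul (ContinuousOn.inv₀ ?_ fun w hw ↦
    (sum_pos_of_mem_cubeFace hw.1 hw.2).ne') ?_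
  · exact (continuous_finsetSum σ fun i _ ↦ continuous_apply i).continuousOn
  · exact (continuous_finsetSum σ fun i _ ↦ (continuous_apply i).smul continuous_const).continuousOn

/-- A map on the `n`-skeleton of the cube into `G`, equal to `g₀` at the origin and to the
weighted mean of the points `j i` on the faces opposite to the origin. Only those faces are
considered for which the corresponding simplex lies in `G`. -/
structure IsCubeFilling (j : ι → E) (G : Set E) (g₀ : E) (n : ℕ) (F : (ι → ℝ) → E) : Prop where
  zero : F 0 = g₀
  continuousOn : ∀ σ : Finset ι, convexHull ℝ (j '' σ) ⊆ G → σ.card ≤ n →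
    ContinuousOn F (cubeFace σ)
  mapsTo : ∀ σ : Finset ι, convexHull ℝ (j '' σ) ⊆ G → σ.card ≤ n → Set.MapsTo F (cubeFace σ) G
  eq_weightedMean : ∀ σ : Finset ι, convexHull ℝ (j '' σ) ⊆ G → σ.card ≤ n →
    ∀ w ∈ cubeFace σ, (∃ i, w i = 1) → F w = weightedMean j w

variable {j : ι → E} {G : Set E} {g₀ : E}

theorem isCubeFilling_zero (hg₀ : g₀ ∈ G) : IsCubeFilling j G g₀ 0 fun _ ↦ g₀ where
  zero := rfl
  continuousOn _ _ _ := continuousOn_const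
  mapsTo _ _ _ _ _ := hg₀
  eq_weightedMean σ _ hσ w hw h1 := by
    obtain rfl : σ = ∅ := Finset.card_eq_zero.1 (Nat.le_zero.1 hσ)
    simpa using sum_pos_of_mem_cubeFace hw h1

theorem convexHull_image_erase_subset [DecidableEq ι] {σ : Finset ι}
    (hσ : convexHull ℝ (j '' σ) ⊆ G) (i : ι) : convexHull ℝ (j '' (σ.erase i : Finset ι)) ⊆ G :=
  (convexHull_mono (Set.image_mono (Finset.coe_subset.2 (σ.erase_subset i)))).trans hσ

theorem mem_cubeFace_erase [DecidableEq ι] {σ : Finset ι} {w : ι → ℝ} (hw : w ∈ cubeFace σ) {i : ι}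
    (hi : w i = 0) : w ∈ cubeFace (σ.erase i) := by
  refine ⟨hw.1, fun k hk ↦ ?_⟩
  rcases eq_or_ne k i with rfl | hki
  · exact hi
  · exact hw.2 k fun h ↦ hk (Finset.mem_erase.2 ⟨hki, h⟩)

/-- A map of the boundary of a face which is null-homotopic in `G` as soon as it is
continuous extends over the face. -/
theorem IsCubeFilling.exists_extension {n : ℕ} {F : (ι → ℝ) → E} (hF : IsCubeFilling j G g₀ n F)
    {σ : Finset ι} (hσ : convexHull ℝ (j '' σ) ⊆ G) (hcard : σ.card = n + 1)
    (hnull : ∀ f : C(cubeFaceBoundary σ, E), (∀ k, f k ∈ G) →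
      ∃ h : C(unitInterval × cubeFaceBoundary σ, E), (∀ k, h (0, k) = f k) ∧
        (∀ k, h (1, k) = g₀) ∧ ∀ p, h p ∈ G) :
    ∃ F' : (ι → ℝ) → E, ContinuousOn F' (cubeFace σ) ∧ Set.MapsTo F' (cubeFace σ) G ∧
      (∀ w ∈ cubeFace σ, (∃ i, w i = 1) → F' w = weightedMean j w) ∧
      ∀ w ∈ cubeFace σ, (∃ i ∈ σ, w i = 0) → F' w = F w := by
  classical
  have hne : σ.Nonempty := Finset.card_pos.1 (by omega)
  let f : (ι → ℝ) → E := fun w ↦ if ∃ i, w i = 1 then weightedMean j w else F w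
  have hcard' : ∀ i ∈ σ, (σ.erase i).card ≤ n := fun i hi ↦ by
    rw [Finset.card_erase_of_mem hi]
    omega
  have hf1 : ∀ w, (∃ i, w i = 1) → f w = weightedMean j w := fun w hw ↦ if_pos hw
  have hf0 : ∀ i ∈ σ, ∀ w ∈ cubeFace (σ.erase i), f w = F w := by
    intro i hi w hw
    by_cases h1 : ∃ i, w i = 1
    · rw [hf1 w h1,
        hF.eq_weightedMean _ (convexHull_image_erase_subset hσ i) (hcard' i hi) w hw h1]
    · exact if_neg h1
  have hcover : cubeFaceBoundary σ ⊆
      {w ∈ cubeFace σ | ∃ i, w i = 1} ∪ ⋃ i : σ, cubeFace (σ.erase i) := by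
    rintro w ⟨hw, i, hi, h0 | h1⟩
    · exact Or.inr (Set.mem_iUnion.2 ⟨⟨i, hi⟩, mem_cubeFace_erase hw h0⟩)
    · exact Or.inl ⟨hw, i, h1⟩
  have hclosed : IsClosed {w ∈ cubeFace σ | ∃ i, w i = 1} := by
    have : {w ∈ cubeFace σ | ∃ i, w i = 1} = cubeFace σ ∩ {w | ∃ i ∈ σ, w i = 1} := by
      ext w
      refine and_congr_right fun hw ↦ ⟨fun ⟨i, hi⟩ ↦ ⟨i, ?_, hi⟩, fun ⟨i, _, hi⟩ ↦ ⟨i, hi⟩⟩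
      by_contra h
      rw [hw.2 i h] at hi
      exact zero_ne_one hi
    rw [this]
    exact (isClosed_cubeFace σ).inter (isClosed_exists_mem_eq σ 1)
  have hfc : ContinuousOn f (cubeFaceBoundary σ) := by
    refine ContinuousOn.mono (ContinuousOn.union_of_isClosed ?_ ?_ hclosed
      (isClosed_iUnion_of_finite fun i ↦ isClosed_cubeFace _)) hcover
    · exact (continuousOn_weightedMean j σ).congr fun w hw ↦ hf1 w hw.2
    · refine (locallyFinite_of_finite _).continuousOn_iUnion (fun i ↦ isClosed_cubeFace _)
        fun i ↦ ?_
      exact (hF.continuousOn _ (convexHull_image_erase_subset hσ i) (hcard' i i.2)).congr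
        fun w hw ↦ hf0 i i.2 w hw
  have hfG : ∀ w ∈ cubeFaceBoundary σ, f w ∈ G := by
    intro w hw
    rcases hcover hw with h1 | h0
    · rw [hf1 w h1.2]
      exact hσ (weightedMean_mem_convexHull j h1.1 h1.2)
    · obtain ⟨i, hi⟩ := Set.mem_iUnion.1 h0
      rw [hf0 i i.2 w hi]
      exact hF.mapsTo _ (convexHull_image_erase_subset hσ i) (hcard' i i.2) hi
  obtain ⟨h, hh0, hh1, hhG⟩ := hnull ⟨_, hfc.domRestrict⟩ fun k ↦ hfG k k.2
  obtain ⟨F', hF'G, hF'⟩ := exists_extension_cubeFace hne h hh1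
  have hF'f : ∀ w (hw : w ∈ cubeFaceBoundary σ), F' ⟨w, hw.1⟩ = f w := fun w hw ↦
    (hF' ⟨w, hw⟩).trans (hh0 _)
  refine ⟨fun w ↦ if hw : w ∈ cubeFace σ then F' ⟨w, hw⟩ else g₀, ?_, ?_, ?_, ?_⟩
  · rw [continuousOn_iff_continuous_domRestrict]
    refine F'.continuous.congr fun w ↦ ?_
    simp
  · intro w hw
    obtain ⟨p, hp⟩ := hF'G ⟨w, hw⟩
    simp only [hw, dif_pos, ← hp]
    exact hhG p
  · rintro w hw ⟨i, hi⟩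
    have hiσ : i ∈ σ := by
      by_contra h
      rw [hw.2 i h] at hi
      exact zero_ne_one hi
    simp only [hw, dif_pos]
    rw [hF'f w ⟨hw, i, hiσ, Or.inr hi⟩, hf1 w ⟨i, hi⟩]
  · rintro w hw ⟨i, hiσ, hi⟩
    simp only [hw, dif_pos]
    rw [hF'f w ⟨hw, i, hiσ, Or.inl hi⟩, hf0 i hiσ w (mem_cubeFace_erase hw hi)]

theorem IsCubeFilling.exists_succ {n : ℕ} {F : (ι → ℝ) → E} (hF : IsCubeFilling j G g₀ n F)
    (hnull : ∀ (σ : Finset ι) (f : C(cubeFaceBoundary σ, E)), (∀ k, f k ∈ G) →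
      ∃ h : C(unitInterval × cubeFaceBoundary σ, E), (∀ k, h (0, k) = f k) ∧
        (∀ k, h (1, k) = g₀) ∧ ∀ p, h p ∈ G) :
    ∃ F' : (ι → ℝ) → E, IsCubeFilling j G g₀ (n + 1) F' ∧
      ∀ σ : Finset ι, σ.card ≤ n → ∀ w ∈ cubeFace σ, F' w = F w := by
  classical
  choose! e hec heG he1 he0 using fun (σ : Finset ι)
    (h : convexHull ℝ (j '' σ) ⊆ G ∧ σ.card = n + 1) ↦ hF.exists_extension h.1 h.2 (hnull σ)
  let P : (ι → ℝ) → Finset ι → Prop := fun w σ ↦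
    (convexHull ℝ (j '' σ) ⊆ G ∧ σ.card = n + 1) ∧ w ∈ cubeFace σ ∧ ∀ i ∈ σ, w i ≠ 0
  let F' : (ι → ℝ) → E := fun w ↦ if h : ∃ σ, P w σ then e h.choose w else F w
  have hsub : ∀ {w σ τ}, P w σ → w ∈ cubeFace τ → σ ⊆ τ := by
    intro w σ τ hσ hτ i hi
    by_contra h
    exact hσ.2.2 i hi (hτ.2 i h)
  have hold : ∀ σ : Finset ι, σ.card ≤ n → ∀ w ∈ cubeFace σ, F' w = F w := by
    intro σ hσ w hw
    refine dif_neg ?_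
    rintro ⟨τ, hτ⟩
    have := Finset.card_le_card (hsub hτ hw)
    have := hτ.1.2
    omega
  have hnew : ∀ σ : Finset ι, convexHull ℝ (j '' σ) ⊆ G → σ.card = n + 1 →
      ∀ w ∈ cubeFace σ, F' w = e σ w := by
    intro σ hσ hcard w hw
    by_cases h0 : ∃ i ∈ σ, w i = 0
    · obtain ⟨i, hi, hwi⟩ := h0
      rw [he0 σ ⟨hσ, hcard⟩ w hw ⟨i, hi, hwi⟩]
      refine hold (σ.erase i) ?_ w (mem_cubeFace_erase hw hwi)
      rw [Finset.card_erase_of_mem hi]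
      omega
    · push Not at h0
      have hP : P w σ := ⟨⟨hσ, hcard⟩, hw, h0⟩
      have hex : ∃ σ, P w σ := ⟨σ, hP⟩
      have hch : hex.choose = σ :=
        Finset.eq_of_subset_of_card_le (hsub hex.choose_spec hw)
          (by rw [hex.choose_spec.1.2, hcard])
      change dite _ _ _ = _
      rw [dif_pos hex, hch]
  refine ⟨F', ⟨?_, ?_, ?_, ?_⟩, hold⟩
  · rw [hold ∅ (by simp) 0 ⟨fun i ↦ by simp, fun i _ ↦ rfl⟩, hF.zero]
  · intro σ hσ hcard
    rcases hcard.lt_or_eq with h | h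
    · exact (hF.continuousOn σ hσ (by omega)).congr (hold σ (by omega))
    · exact (hec σ ⟨hσ, h⟩).congr (hnew σ hσ h)
  · intro σ hσ hcard
    rcases hcard.lt_or_eq with h | h
    · exact (hF.mapsTo σ hσ (by omega)).congr fun w hw ↦ (hold σ (by omega) w hw).symm
    · exact (heG σ ⟨hσ, h⟩).congr fun w hw ↦ (hnew σ hσ h w hw).symm
  · intro σ hσ hcard w hw h1
    rcases hcard.lt_or_eq with h | h
    · rw [hold σ (by omega) w hw, hF.eq_weightedMean σ hσ (by omega) w hw h1]
    · rw [hnew σ hσ h w hw, he1 σ ⟨hσ, h⟩ w hw h1]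

theorem exists_isCubeFilling (hg₀ : g₀ ∈ G)
    (hnull : ∀ (σ : Finset ι) (f : C(cubeFaceBoundary σ, E)), (∀ k, f k ∈ G) →
      ∃ h : C(unitInterval × cubeFaceBoundary σ, E), (∀ k, h (0, k) = f k) ∧
        (∀ k, h (1, k) = g₀) ∧ ∀ p, h p ∈ G) :
    ∃ F : (ι → ℝ) → E, ∀ n, IsCubeFilling j G g₀ n F := by
  classical
  choose! s hs hsF using fun (n : ℕ) (F : (ι → ℝ) → E) (hF : IsCubeFilling j G g₀ n F) ↦
    hF.exists_succ hnull
  let F : ℕ → (ι → ℝ) → E := fun n ↦ Nat.rec (fun _ ↦ g₀) s n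
  have hF : ∀ n, IsCubeFilling j G g₀ n (F n) := fun n ↦ by
    induction n with
    | zero => exact isCubeFilling_zero hg₀
    | succ n ih => exact hs n _ ih
  have hstab : ∀ m n, m ≤ n → ∀ σ : Finset ι, σ.card ≤ m → ∀ w ∈ cubeFace σ, F n w = F m w := by
    intro m n hmn σ hσ w hw
    induction n, hmn using Nat.le_induction with
    | base => rfl
    | succ n hmn ih => exact (hsF n _ (hF n) σ (hσ.trans hmn) w hw).trans ih
  let F' : (ι → ℝ) → E := fun w ↦ F (Function.support w).ncard w
  have hF' : ∀ n, ∀ σ : Finset ι, σ.card ≤ n → ∀ w ∈ cubeFace σ, F' w = F n w := by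
    intro n σ hσ w hw
    have hsub : Function.support w ⊆ σ := fun i hi ↦ by
      by_contra h
      exact hi (hw.2 i h)
    have hfin : (Function.support w).Finite := σ.finite_toSet.subset hsub
    refine (hstab _ n ((Set.ncard_le_ncard hsub).trans ?_) hfin.toFinset ?_ w
      ⟨hw.1, fun i hi ↦ ?_⟩).symm
    · rwa [Set.ncard_coe_finset]
    · rw [Set.ncard_eq_toFinset_card _ hfin]
    · simpa using hi
  refine ⟨F', fun n ↦ ⟨?_, fun σ hσ hn ↦ ?_, fun σ hσ hn ↦ ?_, fun σ hσ hn w hw h1 ↦ ?_⟩⟩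
  · rw [hF' 0 ∅ (by simp) 0 ⟨fun i ↦ by simp, fun i _ ↦ rfl⟩, (hF 0).zero]
  · exact ((hF n).continuousOn σ hσ hn).congr (hF' n σ hn)
  · exact ((hF n).mapsTo σ hσ hn).congr fun w hw ↦ (hF' n σ hn w hw).symm
  · rw [hF' n σ hn w hw, (hF n).eq_weightedMean σ hσ hn w hw h1]

end Filling

section Globalization

/-- Let `G` be a set in a normed space such that compact families in `G` are null-homotopic.
Then every family in `G` parametrized by a paracompact space is null-homotopic, provided that
the unit balls around its members lie in `G`. -/
theorem exists_nullhomotopy_of_compact {Y E : Type*} [TopologicalSpace Y] [NormalSpace Y]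
    [ParacompactSpace Y] [NormedAddCommGroup E] [NormedSpace ℝ E] {G : Set E} {g₀ : E}
    (hg₀ : g₀ ∈ G) (j : C(Y, E)) (hball : ∀ y, Metric.ball (j y) 1 ⊆ G)
    (hnull : ∀ (σ : Finset Y) (f : C(cubeFaceBoundary σ, E)), (∀ k, f k ∈ G) →
      ∃ h : C(unitInterval × cubeFaceBoundary σ, E), (∀ k, h (0, k) = f k) ∧
        (∀ k, h (1, k) = g₀) ∧ ∀ p, h p ∈ G) :
    ∃ (j' : C(Y, E)) (h : j.Homotopy j') (h' : j'.Homotopy (.const Y g₀)),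
      (∀ p, h p ∈ G) ∧ ∀ p, h' p ∈ G := by
  obtain ⟨F, hF⟩ := exists_isCubeFilling (j := j) hg₀ hnull
  obtain ⟨φ, hφ⟩ := BumpCovering.exists_isSubordinate isClosed_univ
    (fun i : Y ↦ {y | ‖j i - j y‖ < 1}) (fun i ↦ isOpen_lt (by fun_prop) continuous_const)
    (fun y _ ↦ Set.mem_iUnion.2 ⟨y, by simp⟩)
  let σ : Y → Finset Y := fun y ↦ (φ.locallyFinite_tsupport.point_finite y).toFinset
  have hσ : ∀ y i, i ∈ σ y ↔ y ∈ tsupport (φ i) := fun y i ↦ by simp [σ]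
  have hσball : ∀ y, convexHull ℝ (j '' σ y) ⊆ Metric.ball (j y) 1 := by
    refine fun y ↦ convexHull_min ?_ (convex_ball _ _)
    rintro _ ⟨i, hi, rfl⟩
    exact mem_ball_iff_norm.2 (hφ i ((hσ y i).1 hi))
  have hσG : ∀ y, convexHull ℝ (j '' σ y) ⊆ G := fun y ↦ (hσball y).trans (hball y)
  have hw : ∀ y, (fun i ↦ φ i y) ∈ cubeFace (σ y) := fun y ↦
    ⟨fun i ↦ ⟨φ.nonneg i y, φ.le_one i y⟩, fun i hi ↦ by
      by_contra h
      exact hi ((hσ y i).2 (subset_tsupport _ h))⟩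
  have hw1 : ∀ y, ∃ i, φ i y = 1 := fun y ↦
    ⟨_, φ.ind_apply y trivial⟩
  have hmap : ∀ (t : unitInterval) (y₀ y : Y), σ y ⊆ σ y₀ →
      (fun i ↦ (1 - (t : ℝ)) * φ i y) ∈ cubeFace (σ y₀) := by
    refine fun t y₀ y hy ↦ ⟨fun i ↦ ?_, fun i hi ↦ ?_⟩
    · have := (hw y).1 i
      have h1 := t.2.1
      have h2 := t.2.2
      constructor
      · exact mul_nonneg (by linarith) this.1
      · nlinarith [this.1, this.2]
    · exact mul_eq_zero_of_right _ ((cubeFace_mono hy (hw y)).2 i hi)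
  have hcont : Continuous fun p : unitInterval × Y ↦ F fun i ↦ (1 - (p.1 : ℝ)) * φ i p.2 := by
    refine continuous_iff_continuousAt.2 fun ⟨t, y₀⟩ ↦ ?_
    have hev : ∀ᶠ y in 𝓝 y₀, σ y ⊆ σ y₀ := by
      filter_upwards [φ.locallyFinite_tsupport.eventually_subset (fun _ ↦ isClosed_closure) y₀]
        with y hy i hi
      exact (hσ y₀ i).2 (hy ((hσ y i).1 hi))
    have hpi : Continuous fun p : unitInterval × Y ↦ fun i ↦ (1 - (p.1 : ℝ)) * φ i p.2 :=
      continuous_pi fun i ↦ by fun_prop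
    have hFc := (hF _).continuousOn (σ y₀) (hσG y₀) le_rfl _ (hmap t y₀ y₀ subset_rfl)
    refine Filter.Tendsto.comp hFc (tendsto_nhdsWithin_iff.2 ⟨hpi.continuousAt, ?_⟩)
    filter_upwards [continuous_snd.tendsto (t, y₀) |>.eventually hev]
      with p hp using hmap p.1 y₀ p.2 hp
  have hmean : ∀ y, F (fun i ↦ φ i y) ∈ Metric.ball (j y) 1 := fun y ↦ by
    rw [(hF _).eq_weightedMean (σ y) (hσG y) le_rfl _ (hw y) (hw1 y)]
    exact hσball y (weightedMean_mem_convexHull j (hw y) (hw1 y))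
  have hcont' : Continuous fun y ↦ F fun i ↦ φ i y := by
    have := hcont.comp (Continuous.prodMk_right (0 : unitInterval))
    simpa [Function.comp_def] using this
  refine ⟨⟨_, hcont'⟩,
    { toFun := fun p ↦ AffineMap.lineMap (j p.2) (F fun i ↦ φ i p.2) (p.1 : ℝ)
      continuous_toFun := ?_
      map_zero_left := fun y ↦ by simp
      map_one_left := fun y ↦ by simp },
    { toFun := fun p ↦ F fun i ↦ (1 - (p.1 : ℝ)) * φ i p.2
      continuous_toFun := hcont
      map_zero_left := fun y ↦ by simp
      map_one_left := fun y ↦ by simpa [← Pi.zero_def] using (hF 0).zero }, ?_, ?_⟩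
  · have := hcont'.comp (continuous_snd (X := unitInterval))
    have hI : Continuous fun p : unitInterval × Y ↦ (p.1 : ℝ) := by fun_prop
    simp only [AffineMap.lineMap_apply_module]
    exact ((continuous_const.sub hI).smul (j.continuous.comp continuous_snd)).add (hI.smul this)
  · exact fun p ↦ hball p.2 ((convex_ball (j p.2) 1).lineMap_mem (Metric.mem_ball_self one_pos)
      (hmean p.2) p.1.2)
  · exact fun p ↦ (hF _).mapsTo (σ p.2) (hσG p.2) le_rfl (hmap p.1 p.2 p.2 subset_rfl)

end Globalization

/-- The unitary part of the polar decomposition retracts the invertible elements of a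
C*-algebra onto the unitary ones. -/
theorem exists_retraction_unitary (A : Type*) [CStarAlgebra A] :
    ∃ r : A → A, ContinuousOn r {a | IsUnit a} ∧ (∀ a, IsUnit a → r a ∈ unitary A) ∧
      ∀ u ∈ unitary A, r u = u := by
  let _ := CStarAlgebra.spectralOrder A
  let _ := CStarAlgebra.spectralOrderedRing A
  have hunit : ∀ a : A, IsUnit a → IsUnit (CFC.sqrt (star a * a)) := fun a ha ↦
    (CFC.isUnit_sqrt_iff _ (star_mul_self_nonneg a)).2 (ha.star.mul ha)
  refine ⟨fun a ↦ a * Ring.inverse (CFC.sqrt (star a * a)), ?_, fun a ha ↦ ?_, fun u hu ↦ ?_⟩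
  · intro a ha
    have hc : Continuous fun a : A ↦ CFC.sqrt (star a * a) := CFC.continuous_abs
    obtain ⟨x, hx⟩ := hunit a ha
    have h1 : ContinuousAt (fun a : A ↦ Ring.inverse (CFC.sqrt (star a * a))) a :=
      ContinuousAt.comp (g := Ring.inverse) (f := fun a : A ↦ CFC.sqrt (star a * a))
        (hx ▸ NormedRing.inverse_continuousAt x) hc.continuousAt
    exact (continuousAt_id.mul h1).continuousWithinAt
  · obtain ⟨x, hx⟩ := hunit a ha
    have hx2 : (x : A) * x = star a * a := by
      rw [hx, CFC.sqrt_mul_sqrt_self _ (star_mul_self_nonneg a)]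
    have hxs : star (x : A) = x := by
      rw [hx]
      exact (CFC.sqrt_nonneg _).isSelfAdjoint
    have hxs' : star (↑x⁻¹ : A) = ↑x⁻¹ := by
      rw [← Units.coe_star_inv, show star x = x from Units.ext hxs]
    simp only [← hx, Ring.inverse_unit]
    have h1 : star (a * (↑x⁻¹ : A)) * (a * ↑x⁻¹) = 1 := by
      rw [star_mul, hxs', mul_assoc, ← mul_assoc (star a), ← hx2, mul_assoc, Units.mul_inv,
        mul_one, Units.inv_mul]
    refine Unitary.mem_iff.2 ⟨h1, ?_⟩
    have hu : IsUnit (a * (↑x⁻¹ : A)) := ha.mul x⁻¹.isUnit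
    obtain ⟨y, hy⟩ := hu
    rw [← hy] at h1 ⊢
    rw [← Units.inv_eq_of_mul_eq_one_left h1, Units.mul_inv]
  · simp only [Unitary.star_mul_self_of_mem hu, CFC.sqrt_one, Ring.inverse_one, mul_one]

/-- The unitary group of a C*-algebra is contractible as soon as compact families of
invertible elements are null-homotopic. -/
theorem CStarAlgebra.contractibleSpace_unitary {A : Type*} [CStarAlgebra A]
    (hnull : ∀ (σ : Finset (unitary A)) (f : C(cubeFaceBoundary σ, A)), (∀ k, IsUnit (f k)) →
      ∃ h : C(unitInterval × cubeFaceBoundary σ, A), (∀ k, h (0, k) = f k) ∧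
        (∀ k, h (1, k) = 1) ∧ ∀ p, IsUnit (h p)) : ContractibleSpace (unitary A) := by
  obtain ⟨r, hrc, hr, hru⟩ := exists_retraction_unitary A
  let j : C(unitary A, A) := ⟨Subtype.val, continuous_subtype_val⟩
  have hball : ∀ u, Metric.ball (j u) 1 ⊆ {a : A | IsUnit a} := by
    intro u x hx
    have hlt : ‖star (u : A) * x - 1‖ < 1 := by
      rw [← Unitary.star_mul_self_of_mem u.2, ← mul_sub]
      have : ‖star (u : A) * (x - u)‖ = ‖x - u‖ :=
        CStarRing.norm_mem_unitary_mul _ (Unitary.star_mem u.2)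
      rw [this]
      exact mem_ball_iff_norm.1 hx
    have hunit : IsUnit (star (u : A) * x) := by
      have := (Units.oneSub (1 - star (u : A) * x) (by rwa [norm_sub_rev])).isUnit
      simpa using this
    have : x = u * (star (u : A) * x) := by
      rw [← mul_assoc, Unitary.mul_star_self_of_mem u.2, one_mul]
    rw [this]
    exact IsUnit.mul (Unitary.toUnits u).isUnit hunit
  obtain ⟨j', h, h', hG, hG'⟩ := exists_nullhomotopy_of_compact (G := {a : A | IsUnit a})
    (g₀ := 1) isUnit_one j hball hnull
  have hretract : ∀ {Z : Type _} [TopologicalSpace Z] (f : C(Z, A)) (hf : ∀ z, IsUnit (f z)),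
      Continuous fun z ↦ (⟨r (f z), hr _ (hf z)⟩ : unitary A) := fun f hf ↦
    (hrc.comp_continuous f.continuous hf).subtype_mk _
  have hj' : ∀ y, IsUnit (j' y) := fun y ↦ by simpa using hG (1, y)
  have H₁ : (ContinuousMap.id (unitary A)).Homotopy ⟨_, hretract j' hj'⟩ :=
    { toFun := fun p ↦ ⟨r (h p), hr _ (hG p)⟩
      continuous_toFun := hretract h.toContinuousMap hG
      map_zero_left := fun y ↦ Subtype.ext (by simpa [j] using hru y y.2)
      map_one_left := fun y ↦ Subtype.ext (by simp) }
  have H₂ : ContinuousMap.Homotopy ⟨_, hretract j' hj'⟩ (.const (unitary A) (1 : unitary A)) :=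
    { toFun := fun p ↦ ⟨r (h' p), hr _ (hG' p)⟩
      continuous_toFun := hretract h'.toContinuousMap hG'
      map_zero_left := fun y ↦ Subtype.ext (by simp)
      map_one_left := fun y ↦ Subtype.ext (by simpa using hru 1 (one_mem _)) }
  exact contractible_iff_id_nullhomotopic _ |>.2 ⟨1, ⟨H₁.trans H₂⟩⟩

/-- Let `X` be a second countable, locally compact Hausdorff space and `H` an
infinite-dimensional separable complex Hilbert space.  Then the unitary group of the
C*-algebra `C_b(X, B(H))` of bounded norm-continuous functions from `X` to the bounded
operators on `H`, with the supremum-norm topology, is contractible. -/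
theorem unitary_boundedContinuousFunction_contractible
    (X : Type*) [TopologicalSpace X] [SecondCountableTopology X]
    [LocallyCompactSpace X] [T2Space X]
    (H : Type*) [NormedAddCommGroup H] [InnerProductSpace ℂ H] [CompleteSpace H]
    [TopologicalSpace.SeparableSpace H] (hH : ¬ FiniteDimensional ℂ H) :
    ContractibleSpace (unitary (BoundedContinuousFunction X (H →L[ℂ] H))) := by
  refine CStarAlgebra.contractibleSpace_unitary fun σ f hf ↦ ?_
  have : CompactSpace (cubeFaceBoundary σ) :=
    isCompact_iff_compactSpace.1 (isCompact_cubeFaceBoundary σ)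
  exact exists_nullhomotopy_isUnit hH f hf
end

section
/- For an infinite-dimensional separable complex Hilbert space H, the group of unitary operators on H is contractible with respect to the operator-norm topology. -/
namespace Kuiper

open Topology ContinuousMap
open scoped unitInterval

section Algebra

variable {R : Type*} [Ring R]

/-- `s` and `t` are embeddings with left inverses `s'` and `t'`, and their ranges are independent. -/
structure IsOrthPair (s s' t t' : R) : Prop where
  ss : s' * s = 1
  tt : t' * t = 1
  st : s' * t = 0
  ts : t' * s = 0

namespace IsOrthPair

variable {s s' t t' : R}

theorem ss_assoc (h : IsOrthPair s s' t t') (z : R) : s' * (s * z) = z := by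
  rw [← mul_assoc, h.ss, one_mul]

theorem tt_assoc (h : IsOrthPair s s' t t') (z : R) : t' * (t * z) = z := by
  rw [← mul_assoc, h.tt, one_mul]

theorem st_assoc (h : IsOrthPair s s' t t') (z : R) : s' * (t * z) = 0 := by
  rw [← mul_assoc, h.st, zero_mul]

theorem ts_assoc (h : IsOrthPair s s' t t') (z : R) : t' * (s * z) = 0 := by
  rw [← mul_assoc, h.ts, zero_mul]

theorem block_mul (h : IsOrthPair s s' t t') (a b c d : R) :
    (s * a * s' + t * b * t') * (s * c * s' + t * d * t') =
      s * (a * c) * s' + t * (b * d) * t' := by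
  simp [mul_add, add_mul, mul_assoc, h.ss_assoc, h.tt_assoc, h.st_assoc, h.ts_assoc]

end IsOrthPair

theorem rotation_mul [Algebra ℝ R] {s s' t t' : R} (h : IsOrthPair s s' t t') {c d : ℝ}
    (hcd : c ^ 2 + d ^ 2 = 1) :
    (1 - (s * s' + t * t') + c • (s * s' + t * t') + d • (t * s' - s * t')) *
      (1 - (s * s' + t * t') + c • (s * s' + t * t') - d • (t * s' - s * t')) = 1 := by
  set E := s * s' + t * t' with hE
  set J := t * s' - s * t' with hJ
  have hEE : E * E = E := by
    simp [hE, mul_add, add_mul, mul_assoc, h.ss_assoc, h.tt_assoc, h.st_assoc, h.ts_assoc]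
  have hEJ : E * J = J := by
    simp [hE, hJ, mul_sub, add_mul, mul_assoc, h.ss_assoc, h.tt_assoc, h.st_assoc, h.ts_assoc]
  have hJE : J * E = J := by
    simp [hE, hJ, mul_add, sub_mul, mul_assoc, h.ss_assoc, h.tt_assoc, h.st_assoc, h.ts_assoc]
    abel
  have hJJ : J * J = -E := by
    simp [hE, hJ, mul_sub, sub_mul, mul_assoc, h.ss_assoc, h.tt_assoc, h.st_assoc, h.ts_assoc]
    abel
  simp only [mul_add, add_mul, mul_sub, sub_mul, smul_mul_assoc, mul_smul_comm, hEE, hEJ, hJE, hJJ,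
    one_mul, mul_one]
  linear_combination (norm := module) hcd • E

end Algebra

section Homotopy

variable {X R : Type*} [TopologicalSpace X] [NormedRing R]

theorem continuous_val (f : C(X, Rˣ)) : Continuous fun x => (f x : R) :=
  Units.continuous_val.comp f.continuous

theorem continuous_inv_val (f : C(X, Rˣ)) : Continuous fun x => (↑(f x)⁻¹ : R) :=
  continuous_val f⁻¹

theorem exists_unitsMap {u v : X → R} (hu : Continuous u) (hv : Continuous v)
    (huv : ∀ x, u x * v x = 1) (hvu : ∀ x, v x * u x = 1) :
    ∃ g : C(X, Rˣ), ∀ x, (g x : R) = u x ∧ (↑(g x)⁻¹ : R) = v x :=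
  ⟨⟨fun x => ⟨u x, v x, huv x, hvu x⟩, Units.continuous_iff.2 ⟨hu, hv⟩⟩, fun _ => ⟨rfl, rfl⟩⟩

theorem homotopic_of_isUnit [CompleteSpace R] {f g : C(X, Rˣ)} (h : I × X → R) (hc : Continuous h)
    (hu : ∀ p, IsUnit (h p)) (h0 : ∀ x, h (0, x) = f x) (h1 : ∀ x, h (1, x) = g x) :
    f.Homotopic g := by
  refine ⟨⟨⟨fun p => (hu p).unit, ?_⟩, fun x => ?_, fun x => ?_⟩⟩
  · exact Units.isOpenEmbedding_val.isEmbedding.continuous_iff.2 hc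
  · exact Units.ext (h0 x)
  · exact Units.ext (h1 x)

theorem homotopic_mul {f f' g g' : C(X, Rˣ)} (h : f.Homotopic f') (k : g.Homotopic g') :
    (f * g).Homotopic (f' * g') := by
  obtain ⟨F⟩ := h
  obtain ⟨G⟩ := k
  exact ⟨⟨⟨fun p => F p * G p, by fun_prop⟩, fun x => by simp, fun x => by simp⟩⟩

theorem homotopic_inv {f f' : C(X, Rˣ)} (h : f.Homotopic f') : f⁻¹.Homotopic f'⁻¹ := by
  obtain ⟨F⟩ := h
  exact ⟨⟨⟨fun p => (F p)⁻¹, by fun_prop⟩, fun x => by simp, fun x => by simp⟩⟩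

variable {s s' t t' : X → R}

/-- Rotation by a right angle in the span of the ranges of `s` and `t`. -/
theorem exists_rotation [CompleteSpace R] [NormedAlgebra ℝ R] (hs : Continuous s)
    (hs' : Continuous s') (ht : Continuous t) (ht' : Continuous t')
    (h : ∀ x, IsOrthPair (s x) (s' x) (t x) (t' x)) :
    ∃ ρ : C(X, Rˣ), ρ.Homotopic 1 ∧ ∀ x,
      (ρ x : R) = 1 - (s x * s' x + t x * t' x) + (t x * s' x - s x * t' x) ∧
      (↑(ρ x)⁻¹ : R) = 1 - (s x * s' x + t x * t' x) - (t x * s' x - s x * t' x) := by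
  obtain ⟨ρ, hρ⟩ := exists_unitsMap
    (u := fun x => 1 - (s x * s' x + t x * t' x) + (t x * s' x - s x * t' x))
    (v := fun x => 1 - (s x * s' x + t x * t' x) - (t x * s' x - s x * t' x))
    (by fun_prop) (by fun_prop)
    (fun x => by simpa using rotation_mul (h x) (c := 0) (d := 1) (by norm_num))
    (fun x => by simpa only [zero_smul, neg_smul, one_smul, add_zero, sub_neg_eq_add,
      ← sub_eq_add_neg] using
      rotation_mul (h x) (c := 0) (d := -1) (by norm_num))
  refine ⟨ρ, ?_, hρ⟩
  let E : X → R := fun x => s x * s' x + t x * t' x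
  let J : X → R := fun x => t x * s' x - s x * t' x
  have hE : Continuous E := by fun_prop
  have hJ : Continuous J := by fun_prop
  refine homotopic_of_isUnit (fun p => 1 - E p.2 + Real.sin (Real.pi / 2 * p.1) • E p.2 +
    Real.cos (Real.pi / 2 * p.1) • J p.2) (by fun_prop) (fun p => ?_) (fun x => ?_) (fun x => ?_)
  · have h1 := rotation_mul (h p.2) (Real.sin_sq_add_cos_sq (Real.pi / 2 * p.1))
    have h2 := rotation_mul (h p.2) (c := Real.sin (Real.pi / 2 * p.1))
      (d := -Real.cos (Real.pi / 2 * p.1)) (by rw [neg_sq, Real.sin_sq_add_cos_sq])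
    simp only [neg_smul, ← sub_eq_add_neg, sub_neg_eq_add] at h2
    exact ⟨⟨_, _, h1, h2⟩, rfl⟩
  · simp [(hρ x).1, E, J]
  · simp [E, J]

theorem exists_block (hs : Continuous s) (hs' : Continuous s')
    (ht : Continuous t) (ht' : Continuous t') (h : ∀ x, IsOrthPair (s x) (s' x) (t x) (t' x))
    (hsum : ∀ x, s x * s' x + t x * t' x = 1) (a b : C(X, Rˣ)) :
    ∃ g : C(X, Rˣ), ∀ x, (g x : R) = s x * a x * s' x + t x * b x * t' x ∧
      (↑(g x)⁻¹ : R) = s x * ↑(a x)⁻¹ * s' x + t x * ↑(b x)⁻¹ * t' x := by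
  have := continuous_val a
  have := continuous_val b
  have := continuous_inv_val a
  have := continuous_inv_val b
  refine exists_unitsMap (by fun_prop) (by fun_prop) (fun x => ?_) (fun x => ?_) <;>
  simp [(h x).block_mul, hsum]

theorem block_homotopic (hs : Continuous s) (hs' : Continuous s')
    (ht : Continuous t) (ht' : Continuous t') (h : ∀ x, IsOrthPair (s x) (s' x) (t x) (t' x))
    (hsum : ∀ x, s x * s' x + t x * t' x = 1) {a b c f g : C(X, Rˣ)} (hbc : b.Homotopic c)
    (hf : ∀ x, (f x : R) = s x * a x * s' x + t x * b x * t' x)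
    (hg : ∀ x, (g x : R) = s x * a x * s' x + t x * c x * t' x) : f.Homotopic g := by
  obtain ⟨F⟩ := hbc
  obtain ⟨G, hG⟩ := exists_block (X := I × X) (s := fun p => s p.2) (s' := fun p => s' p.2)
    (t := fun p => t p.2) (t' := fun p => t' p.2) (by fun_prop) (by fun_prop) (by fun_prop)
    (by fun_prop) (fun p => h p.2) (fun p => hsum p.2) (a.comp ⟨Prod.snd, continuous_snd⟩)
    F.toContinuousMap
  refine ⟨⟨G, fun x => Units.ext ?_, fun x => Units.ext ?_⟩⟩
  · simp [(hG _).1, hf]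
  · simp [(hG _).1, hg]

/-- The block-diagonal unit with entries `b` and `b⁻¹` is homotopic to `1`. -/
theorem block_inv_homotopic_one [CompleteSpace R] [NormedAlgebra ℝ R] (hs : Continuous s)
    (hs' : Continuous s') (ht : Continuous t) (ht' : Continuous t')
    (h : ∀ x, IsOrthPair (s x) (s' x) (t x) (t' x))
    (hsum : ∀ x, s x * s' x + t x * t' x = 1) (b : C(X, Rˣ)) {g : C(X, Rˣ)}
    (hg : ∀ x, (g x : R) = s x * b x * s' x + t x * ↑(b x)⁻¹ * t' x) : g.Homotopic 1 := by
  obtain ⟨ρ, hρ1, hρ⟩ := exists_rotation hs hs' ht ht' h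
  obtain ⟨P, hP⟩ := exists_block hs hs' ht ht' h hsum b 1
  have hgP : g = P * ρ * P⁻¹ * ρ⁻¹ := by
    ext x
    have hx := h x
    simp only [ContinuousMap.mul_apply, ContinuousMap.inv_apply, Units.val_mul, hρ, hP, hg, hsum]
    simp [mul_add, add_mul, mul_sub, sub_mul, mul_assoc, hx.ss_assoc, hx.tt_assoc, hx.st_assoc,
      hx.ts_assoc, add_comm]
  rw [hgP]
  have := homotopic_mul (homotopic_mul (homotopic_mul (.refl P) hρ1) (.refl P⁻¹))
    (homotopic_inv hρ1)
  simpa using this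

/-- `Φ` behaves like an infinite block-diagonal amplification `a ↦ diag (a, a, …)`, where `v`
embeds the first block and `w` shifts the blocks. -/
structure IsAmplification (v v' w w' : R) (Φ : R →* R) : Prop where
  pair : IsOrthPair v v' w w'
  sum_eq : v * v' + w * w' = 1
  apply_eq : ∀ a, Φ a = v * a * v' + w * Φ a * w'
  continuous : Continuous Φ

/-- The Eilenberg swindle: if `Φ` is an infinite amplification, then `diag (f, 1)` is homotopic
to `1`. -/
theorem swindle [CompleteSpace R] [NormedAlgebra ℝ R] {v v' w w' : R} {Φ : R →* R}
    (hΦ : IsAmplification v v' w w' Φ) (hs : Continuous s) (hs' : Continuous s')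
    (ht : Continuous t) (ht' : Continuous t') (h : ∀ x, IsOrthPair (s x) (s' x) (t x) (t' x))
    (hsum : ∀ x, s x * s' x + t x * t' x = 1) (f : C(X, Rˣ)) {g : C(X, Rˣ)}
    (hg : ∀ x, (g x : R) = s x * f x * s' x + t x * t' x) : g.Homotopic 1 := by
  have hvw := hΦ.pair
  have hvwsum := hΦ.sum_eq
  let b : C(X, Rˣ) := ⟨fun x => Units.map Φ (f x),
    (Continuous.units_map Φ hΦ.continuous).comp f.continuous⟩
  obtain ⟨c, hc⟩ := exists_block (X := X) (s := fun _ => v) (s' := fun _ => v') (t := fun _ => w)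
    (t' := fun _ => w') continuous_const continuous_const continuous_const continuous_const
    (fun _ => hvw) (fun _ => hvwsum) b b⁻¹
  have hc1 : c.Homotopic 1 := block_inv_homotopic_one (X := X) (s := fun _ => v)
    (s' := fun _ => v') (t := fun _ => w)
    (t' := fun _ => w') continuous_const continuous_const continuous_const continuous_const
    (fun _ => hvw) (fun _ => hvwsum) b (fun x => (hc x).1)
  obtain ⟨g', hg'⟩ := exists_block hs hs' ht ht' h hsum f c
  have hgg' : g'.Homotopic g := block_homotopic hs hs' ht ht' h hsum hc1
    (fun x => (hg' x).1) (fun x => by simp [hg])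
  refine hgg'.symm.trans ?_
  refine block_inv_homotopic_one (s := fun x => s x * v' + t x * v * w')
    (s' := fun x => v * s' x + w * v' * t' x) (t := fun x => t x * w) (t' := fun x => w' * t' x)
    (by fun_prop) (by fun_prop) (by fun_prop) (by fun_prop) (fun x => ?_) (fun x => ?_) b
    (fun x => ?_)
  · have hx := h x
    set_option linter.unusedSimpArgs false in
    constructor <;>
    simp [mul_add, add_mul, mul_assoc, hx.ss_assoc, hx.tt_assoc, hx.st_assoc,
      hx.ts_assoc, hx.ss, hx.tt, hx.st, hx.ts, hvw.ss, hvw.tt, hvw.st, hvw.ts, hvw.ss_assoc,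
      hvw.tt_assoc, hvw.st_assoc, hvw.ts_assoc, hvwsum]
  · calc _ = s x * s' x + t x * (v * v' + w * w') * t' x := by
          simp [mul_add, add_mul, mul_assoc, hvw.ss_assoc,
            hvw.tt_assoc, hvw.st_assoc, hvw.ts_assoc, add_assoc]
      _ = 1 := by simp [hvwsum, hsum]
  · have e1 : (b x : R) = v * f x * v' + w * b x * w' := hΦ.apply_eq (f x)
    rw [(hg' x).1, (hc x).1]
    conv_rhs => rw [e1]
    simp [mul_add, add_mul, mul_assoc, hvw.ss_assoc,
            hvw.tt_assoc, hvw.st_assoc, hvw.ts_assoc, add_assoc]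

variable {A A' B B' : X → R}

/-- A family of units fixing a continuously varying copy of the whole space is homotopic
to `1`. -/
theorem homotopic_one_of_fix [CompleteSpace R] [NormedAlgebra ℝ R] {v v' w w' : R} {Φ : R →* R}
    (hΦ : IsAmplification v v' w w' Φ) (hA : Continuous A) (hA' : Continuous A')
    (hAA : ∀ x, A' x * A x = 1) (f : C(X, Rˣ)) (hf : ∀ x, f x * A x = A x) :
    f.Homotopic 1 := by
  have hAA' (x) (z : R) : A' x * (A x * z) = z := by rw [← mul_assoc, hAA, one_mul]
  have hf' (x) (z : R) : f x * (A x * z) = A x * z := by rw [← mul_assoc, hf]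
  have := continuous_val f
  have hvw := hΦ.pair
  let N : X → R := fun x => A x * A' x * f x * (1 - A x * A' x)
  have hN : Continuous N := by fun_prop
  have hNN (x) : N x * N x = 0 := by
    simp [N, mul_assoc, sub_mul, mul_sub, hAA']
  have hfN (x) : f x * N x = N x := by
    simp [N, mul_assoc, mul_sub, hAA', hf']
  obtain ⟨U, hU⟩ := exists_unitsMap (u := fun x => 1 - N x) (v := fun x => 1 + N x)
    (by fun_prop) (by fun_prop) (fun x => by simp [mul_add, sub_mul, hNN])
    (fun x => by simp [add_mul, mul_sub, hNN])
  have hU1 : U.Homotopic 1 := by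
    refine homotopic_of_isUnit (fun p => 1 - ((1 - p.1 : ℝ)) • N p.2) (by fun_prop) (fun p => ?_)
      (fun x => by simp [hU]) (fun x => by simp)
    exact ⟨⟨_, 1 + ((1 - p.1 : ℝ)) • N p.2, by simp [mul_add, sub_mul, hNN],
      by simp [mul_sub, add_mul, hNN]⟩, rfl⟩
  have hfU : (f * U).Homotopic 1 := by
    refine swindle hΦ (s := fun x => 1 - A x * A' x + A x * v * A' x)
      (s' := fun x => 1 - A x * A' x + A x * v' * A' x) (t := fun x => A x * w)
      (t' := fun x => w' * A' x) (by fun_prop) (by fun_prop) (by fun_prop) (by fun_prop)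
      (fun x => ?_) (fun x => ?_) (f * U) (fun x => ?_)
    · set_option linter.unusedSimpArgs false in
      constructor <;>
      simp [mul_add, add_mul, mul_sub, sub_mul, mul_assoc, hAA', hAA, hvw.ss,
        hvw.tt, hvw.st, hvw.ts, hvw.ss_assoc, hvw.tt_assoc, hvw.st_assoc, hvw.ts_assoc]
    · calc _ = 1 - A x * A' x + A x * (v * v' + w * w') * A' x := by
            simp [mul_add, add_mul, mul_sub, sub_mul, mul_assoc, hAA', add_assoc]
        _ = 1 := by simp [hΦ.sum_eq]
    · have e : (f x : R) * U x = f x - A x * A' x * f x * (1 - A x * A' x) := by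
        rw [(hU x).1, mul_sub, hfN, mul_one]
      simp only [ContinuousMap.mul_apply, Units.val_mul, e]
      have e2 : A x * A' x = A x * (v * v') * A' x + A x * (w * w') * A' x := by
        rw [← add_mul, ← mul_add, hΦ.sum_eq, mul_one]
      simp [mul_add, add_mul, mul_sub, sub_mul, mul_assoc, hAA', hf'] at e2 ⊢
      rw [e2]
      abel
  have := homotopic_mul hfU (homotopic_inv hU1)
  simpa using this

/-- A family of units which sends a copy of the whole space into a complement of another copy is
homotopic to `1`. -/
theorem homotopic_one_of_orth [CompleteSpace R] [NormedAlgebra ℝ R] {v v' w w' : R} {Φ : R →* R}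
    (hΦ : IsAmplification v v' w w' Φ) (hA : Continuous A) (hA' : Continuous A')
    (hB : Continuous B) (hB' : Continuous B') (h : ∀ x, IsOrthPair (A x) (A' x) (B x) (B' x))
    (f : C(X, Rˣ)) (hf : ∀ x, B' x * f x * A x = 0) : f.Homotopic 1 := by
  have := continuous_val f
  have := continuous_inv_val f
  have hf' (x) (z : R) : B' x * (f x * (A x * z)) = 0 := by
    rw [← mul_assoc, ← mul_assoc, hf, zero_mul]
  obtain ⟨ρ, hρ1, hρ⟩ := exists_rotation (s := fun x => f x * A x)
    (s' := fun x => A' x * ↑(f x)⁻¹ * (1 - B x * B' x)) (t := B) (t' := B')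
    (by fun_prop) (by fun_prop) hB hB' (fun x => by
      have hx := h x
      constructor <;>
      simp [mul_sub, sub_mul, mul_assoc, hx.ss, hx.tt, ← mul_assoc (B' x), hf])
  obtain ⟨τ, hτ1, hτ⟩ := exists_rotation hB hB' hA hA' (fun x => by
    have hx := h x
    exact ⟨hx.tt, hx.ss, hx.ts, hx.st⟩)
  have key : (τ * ρ * f).Homotopic 1 := by
    refine homotopic_one_of_fix hΦ hA hA' (fun x => (h x).ss) _ (fun x => ?_)
    have hx := h x
    have hf1 := hf x
    rw [mul_assoc] at hf1
    have e1 : (ρ x : R) * (f x * A x) = B x := by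
      rw [(hρ x).1]
      simp [add_mul, mul_sub, sub_mul, mul_assoc, hx.ss, hf1]
    have e2 : (τ x : R) * B x = A x := by
      rw [(hτ x).1]
      simp [add_mul, sub_mul, mul_assoc, hx.tt, hx.st]
    simp [mul_assoc, e1, e2]
  have := homotopic_mul (homotopic_mul (homotopic_inv hρ1) (homotopic_inv hτ1)) key
  simpa [mul_assoc] using this

end Homotopy

section Hilbert

open scoped InnerProductSpace ENNReal

variable {H : Type*} [NormedAddCommGroup H] [InnerProductSpace ℂ H]

theorem countable_of_orthonormal [TopologicalSpace.SeparableSpace H] {ι : Type*} {v : ι → H}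
    (hv : Orthonormal ℂ v) : Countable ι := by
  refine Pairwise.countable_of_isOpen_disjoint (s := fun i => Metric.ball (v i) (1 / 2))
    (fun i j hij => ?_) (fun i => Metric.isOpen_ball) (fun i => ⟨v i, by simp⟩)
  refine Metric.ball_disjoint_ball ?_
  have h : ‖v i - v j‖ * ‖v i - v j‖ = 1 + 1 := by
    rw [@norm_sub_mul_self ℂ, hv.2 hij, hv.1, hv.1]
    simp
  rw [dist_eq_norm]
  nlinarith [norm_nonneg (v i - v j)]

theorem exists_hilbertBasis_nat [CompleteSpace H] [TopologicalSpace.SeparableSpace H]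
    (hH : ¬ FiniteDimensional ℂ H) : Nonempty (HilbertBasis ℕ ℂ H) := by
  obtain ⟨w, b, -⟩ := exists_hilbertBasis ℂ H
  have := countable_of_orthonormal b.orthonormal
  have : Infinite w := by
    by_contra hw
    rw [not_infinite_iff_finite] at hw
    have := Fintype.ofFinite w
    exact hH (b.toOrthonormalBasis.toBasis.finiteDimensional_of_finite)
  obtain ⟨e⟩ := nonempty_equiv_of_countable (α := ℕ) (β := w)
  exact ⟨HilbertBasis.mk (b.orthonormal.comp e e.injective)
    (by rw [e.surjective.range_comp, b.dense_span])⟩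

theorem ext_basis (b : HilbertBasis ℕ ℂ H) {T S : H →L[ℂ] H} (h : ∀ k, T (b k) = S (b k)) : T = S :=
  ContinuousLinearMap.ext_on (Submodule.dense_iff_topologicalClosure_eq_top.2 b.dense_span)
    (by rintro _ ⟨k, rfl⟩; exact h k)

theorem eq_zero_of_inner_basis (b : HilbertBasis ℕ ℂ H) {x : H} (h : ∀ k, ⟪b k, x⟫_ℂ = 0) :
    x = 0 := by
  rw [← map_eq_zero_iff b.repr b.repr.injective]
  ext k
  simpa [b.repr_apply_apply] using h k

variable [CompleteSpace H]

theorem star_mul_mul_eq_zero (b : HilbertBasis ℕ ℂ H) {V G W : H →L[ℂ] H}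
    (h : ∀ k l, ⟪V (b k), G (W (b l))⟫_ℂ = 0) : star V * G * W = 0 := by
  refine ext_basis b fun l => eq_zero_of_inner_basis b fun k => ?_
  simpa [ContinuousLinearMap.star_eq_adjoint, ContinuousLinearMap.adjoint_inner_right] using h k l

theorem exists_isometry (b : HilbertBasis ℕ ℂ H) {v : ℕ → H} (hv : Orthonormal ℂ v) :
    ∃ V : H →L[ℂ] H, (∀ k, V (b k) = v k) ∧ star V * V = 1 := by
  let J : H →ₗᵢ[ℂ] H := hv.orthogonalFamily.linearIsometry.comp b.repr.toLinearIsometry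
  refine ⟨J.toContinuousLinearMap, fun k => ?_, ?_⟩
  · simp [J, b.repr_self]
  · exact J.adjoint_comp_self

/-- The block-diagonal operator with all blocks equal to `a`. -/
theorem exists_diagonal {s : ℕ → H →ₗᵢ[ℂ] H} (hs : IsHilbertSum ℂ (fun _ : ℕ => H) s)
    (a : H →L[ℂ] H) : ∃ T : H →L[ℂ] H, ‖T‖ ≤ ‖a‖ ∧ ∀ n x, T (s n x) = s n (a x) := by
  have h2 : 0 < (2 : ℝ≥0∞).toReal := by norm_num
  have hle (f : lp (fun _ : ℕ => H) 2) (n) :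
      ‖a (f n)‖ ^ (2 : ℝ≥0∞).toReal ≤ ‖a‖ ^ (2 : ℝ≥0∞).toReal * ‖f n‖ ^ (2 : ℝ≥0∞).toReal := by
    rw [← Real.mul_rpow (norm_nonneg _) (norm_nonneg _)]
    exact Real.rpow_le_rpow (norm_nonneg _) (a.le_opNorm _) h2.le
  have hsum (f : lp (fun _ : ℕ => H) 2) := ((lp.memℓp f).summable h2).mul_left
    (‖a‖ ^ (2 : ℝ≥0∞).toReal)
  have hmem (f : lp (fun _ : ℕ => H) 2) : Memℓp (fun n => a (f n)) 2 :=
    memℓp_gen ((hsum f).of_nonneg_of_le (fun n => by positivity) (hle f))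
  let D₀ : lp (fun _ : ℕ => H) 2 →ₗ[ℂ] lp (fun _ : ℕ => H) 2 :=
    { toFun := fun f => ⟨fun n => a (f n), hmem f⟩
      map_add' := fun f g => by ext n; exact map_add a _ _
      map_smul' := fun c f => by ext n; simp }
  let D := D₀.mkContinuous ‖a‖ fun f => by
    refine lp.norm_le_of_tsum_le h2 (by positivity) ?_
    rw [Real.mul_rpow (norm_nonneg _) (norm_nonneg _), lp.norm_rpow_eq_tsum h2, ← tsum_mul_left]
    exact Summable.tsum_le_tsum (hle f) ((lp.memℓp (D₀ f)).summable h2) (hsum f)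
  let θ := hs.linearIsometryEquiv
  refine ⟨θ.symm.toContinuousLinearEquiv.toContinuousLinearMap ∘L D ∘L
    θ.toContinuousLinearEquiv.toContinuousLinearMap, ?_, fun n x => ?_⟩
  · refine ContinuousLinearMap.opNorm_le_bound _ (norm_nonneg _) fun x => ?_
    have := D.le_of_opNorm_le (D₀.mkContinuous_norm_le (norm_nonneg a) _) (θ x)
    simpa using this
  · have hθ (x) : s n x = θ.symm (lp.single 2 n x) :=
      (hs.linearIsometryEquiv_symm_apply_single x).symm
    have : D (lp.single 2 n x) = lp.single 2 n (a x) := by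
      ext m
      by_cases h : m = n
      · subst h; simp [D, D₀]
      · simp [D, D₀, h, lp.single_apply, Pi.single_apply]
    simp [hθ, this]

theorem exists_isAmplification (b : HilbertBasis ℕ ℂ H) :
    ∃ (v v' w w' : H →L[ℂ] H) (Φ : (H →L[ℂ] H) →* (H →L[ℂ] H)),
      IsAmplification v v' w w' Φ := by
  have hU (f : ℕ → ℕ) (hf : f.Injective) := exists_isometry b (b.orthonormal.comp f hf)
  choose U hUb hUU using hU
  have horth {f g : ℕ → ℕ} (hf : f.Injective) (hg : g.Injective) (hfg : ∀ k l, f k ≠ g l) :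
      star (U f hf) * U g hg = 0 := by
    have := star_mul_mul_eq_zero b (V := U f hf) (G := 1) (W := U g hg) (fun k l => by
      simpa [hUb] using b.orthonormal.2 (hfg k l))
    simpa using this
  have hp (n) : Function.Injective (Nat.pair n) := fun k l h => (Nat.pair_eq_pair.1 h).2
  let sh : ℕ → ℕ := fun k => Nat.pair (k.unpair.1 + 1) k.unpair.2
  have hsh : sh.Injective := fun k l h => by
    have h := Nat.pair_eq_pair.1 h
    rw [← Nat.pair_unpair k, ← Nat.pair_unpair l, Nat.add_right_cancel h.1, h.2]
  let s (n : ℕ) : H →L[ℂ] H := U _ (hp n)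
  have hsb (n k) : s n (b k) = b (Nat.pair n k) := hUb _ _ k
  let w : H →L[ℂ] H := U sh hsh
  have hw (n) : w * s n = s (n + 1) := ext_basis b fun k => by
    simp [hsb, w, hUb, sh]
  have hext {T S : H →L[ℂ] H} (h : ∀ n, T * s n = S * s n) : T = S := ext_basis b fun k => by
    rw [← Nat.pair_unpair k, ← hsb]
    exact DFunLike.congr_fun (h _) _
  have hss (n) : star (s n) * s n = 1 := hUU _ _
  have hss0 (m n) (hmn : m ≠ n) : star (s m) * s n = 0 :=
    horth _ _ fun k l h => hmn (Nat.pair_eq_pair.1 h).1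
  have hww : star w * w = 1 := hUU _ _
  have h0w : star (s 0) * w = 0 := horth _ _ fun k l h => by
    have := (Nat.pair_eq_pair.1 h).1
    omega
  have hw0 : star w * s 0 = 0 := by simpa using congrArg star h0w
  have hiso (n) : ∀ x, ‖s n x‖ = ‖x‖ := (s n).norm_map_iff_adjoint_comp_self.2 (hss n)
  let si (n) : H →ₗᵢ[ℂ] H := ⟨(s n).toLinearMap, hiso n⟩
  have hsum : IsHilbertSum ℂ (fun _ : ℕ => H) si := by
    refine IsHilbertSum.mk (fun m n hmn x y => ?_) ?_
    · have := DFunLike.congr_fun (hss0 m n hmn) y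
      change ⟪s m x, s n y⟫_ℂ = 0
      rw [← ContinuousLinearMap.adjoint_inner_right]
      change ⟪x, (star (s m) * s n) y⟫_ℂ = 0
      rw [this]; simp
    · rw [← b.dense_span]
      refine Submodule.topologicalClosure_mono (Submodule.span_le.2 ?_)
      rintro _ ⟨k, rfl⟩
      refine Submodule.mem_iSup_of_mem k.unpair.1 ⟨b k.unpair.2, ?_⟩
      change s _ _ = _
      rw [hsb, Nat.pair_unpair]
  choose Φ hΦ hΦs using exists_diagonal hsum
  have hΦs' (a n) : Φ a * s n = s n * a := by
    ext x; exact hΦs a n x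
  refine ⟨s 0, star (s 0), w, star w, ⟨⟨Φ, hext fun n => by simp [hΦs']⟩,
    fun a c => hext fun n => by
    change Φ (a * c) * _ = Φ a * Φ c * _
    rw [hΦs', mul_assoc, hΦs', ← mul_assoc, ← mul_assoc, hΦs']⟩, ⟨hss 0, hww, h0w, hw0⟩,
    hext fun n => ?_, fun a => hext fun n => ?_, ?_⟩
  · cases n with
    | zero => simp [add_mul, mul_assoc, hss, hw0]
    | succ n =>
      rw [add_mul, mul_assoc, mul_assoc, hss0 _ _ (by omega), ← hw n, ← mul_assoc _ w, hww]
      simp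
  · change Φ a * _ = (_ + _ * Φ a * _) * _
    cases n with
    | zero => simp [add_mul, mul_assoc, hss, hw0, hΦs']
    | succ n =>
      rw [add_mul, mul_assoc, hss0 _ _ (by omega), hΦs', ← hw n, mul_assoc _ (star w),
        ← mul_assoc _ w, hww, one_mul, mul_assoc w (Φ a), hΦs']
      simp [mul_assoc]
  · have hsub (a c) : Φ a - Φ c = Φ (a - c) := hext fun n => by simp [sub_mul, hΦs', mul_sub]
    refine (LipschitzWith.of_dist_le_mul (K := 1) fun a c => ?_).continuous
    simpa [dist_eq_norm, hsub] using hΦ (a - c)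

end Hilbert

section Polar

/-- The unitary part `a * (star a * a) ^ (-1 / 2)` of the polar decomposition retracts the units
onto the unitary group. -/
theorem exists_unitary_retraction {A : Type*} [CStarAlgebra A] :
    ∃ r : C(Aˣ, unitary A), ∀ u : unitary A, r (Unitary.toUnits u) = u := by
  let _ : PartialOrder A := CStarAlgebra.spectralOrder A
  have : StarOrderedRing A := CStarAlgebra.spectralOrderedRing A
  let φ : ℝ → ℝ := fun t => (√t)⁻¹
  let P : Aˣ → A := fun a => cfc φ (star (a : A) * a)
  have hpos (a : Aˣ) : ∀ t ∈ spectrum ℝ (star (a : A) * a), 0 < t := by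
    intro t ht
    refine lt_of_le_of_ne (spectrum_nonneg_of_nonneg (star_mul_self_nonneg _) ht) ?_
    rintro rfl
    exact spectrum.zero_notMem ℝ (a.isUnit.star.mul a.isUnit) ht
  have hφ : ContinuousOn φ (Set.Ioi 0) := fun t ht =>
    (Real.continuous_sqrt.continuousAt.inv₀ (Real.sqrt_pos.2 ht).ne').continuousWithinAt
  have hφa (a : Aˣ) : ContinuousOn φ (spectrum ℝ (star (a : A) * a)) := hφ.mono (hpos a)
  have hsa (a : Aˣ) : IsSelfAdjoint (star (a : A) * a) := .star_mul_self _
  have hP : Continuous P := by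
    refine Continuous.cfc_of_mem_nhdsSet (s := Set.Ioi 0) φ ?_ ?_ hsa hφ
    · rw [isOpen_Ioi.mem_nhdsSet]
      exact Set.iUnion_subset hpos
    · exact Units.continuous_val.star.mul Units.continuous_val
  have hPs (a) : star (P a) = P a := (cfc_predicate φ (star (a : A) * a) : IsSelfAdjoint _)
  have hid (a : Aˣ) : cfc (fun t : ℝ => t) (star (a : A) * a) = star (a : A) * a :=
    cfc_id' ℝ _
  have hPP (a : Aˣ) : P a * (star (a : A) * a) * P a = 1 := by
    rw [← hid a, ← cfc_mul φ (fun t => t) _ (hφa a) continuousOn_id,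
      ← cfc_mul (fun t => φ t * t) φ _ ((hφa a).mul continuousOn_id) (hφa a),
      ← cfc_one ℝ (star (a : A) * a)]
    refine cfc_congr fun t ht => ?_
    have ht := hpos a t ht
    have h1 := Real.mul_self_sqrt ht.le
    have h2 := (Real.sqrt_pos.2 ht).ne'
    simp only [φ, Pi.one_apply]
    field_simp
    rw [sq, h1]
  have hPu (a) : IsUnit (P a) := by
    have hcomm : P a * (star (a : A) * a) = star (a : A) * a * P a := by
      have := cfc_commute_cfc φ (fun t : ℝ => t) (star (a : A) * a)
      rwa [hid] at this
    exact isUnit_iff_exists.2 ⟨star (a : A) * a * P a, by rw [← mul_assoc, hPP],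
      by rw [← hcomm, hPP]⟩
  have hU (a : Aˣ) : (a : A) * P a ∈ unitary A := by
    have h : star ((a : A) * P a) * (a * P a) = 1 := by
      rw [star_mul, hPs, ← hPP a]
      simp [mul_assoc]
    obtain ⟨u, hu⟩ : IsUnit ((a : A) * P a) := a.isUnit.mul (hPu a)
    rw [← hu] at h ⊢
    exact ⟨h, by rw [Units.eq_inv_of_mul_eq_one_right h, Units.mul_inv]⟩
  refine ⟨⟨fun a => ⟨a * P a, hU a⟩, ?_⟩, fun u => ?_⟩
  · exact (Units.continuous_val.mul hP).subtype_mk _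
  · ext
    have : P (Unitary.toUnits u) = 1 := by
      simp [P, cfc_apply_one, φ]
    simp [this]
end Polar

section Sequences

open scoped InnerProductSpace

variable {H : Type*} [NormedAddCommGroup H] [InnerProductSpace ℂ H]

theorem exists_add_mul_lt_two_pow (a c : ℕ) : ∃ m, a + c * m < 2 ^ m := by
  refine ⟨2 * (2 * (a + c)), ?_⟩
  have h := (2 * (a + c)).lt_two_pow_self
  rw [pow_mul', sq]
  nlinarith

/-- Finitely many vectors, together with finitely many sequences whose `k`-th terms vanish on the
first `2 ^ k` basis vectors, do not span a dense subspace. -/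
theorem exists_unit_orthogonal (b : HilbertBasis ℕ ℂ H) (F : Finset H) (Y : Finset (ℕ → H))
    (hY : ∀ y ∈ Y, ∀ k, ∀ i < 2 ^ k, ⟪b i, y k⟫_ℂ = 0) :
    ∃ v : H, ‖v‖ = 1 ∧ (∀ x ∈ F, ⟪x, v⟫_ℂ = 0) ∧ ∀ y ∈ Y, ∀ k, ⟪y k, v⟫_ℂ = 0 := by
  obtain ⟨m, hm⟩ := exists_add_mul_lt_two_pow F.card Y.card
  let c : F ⊕ (Y × Fin m) → H := Sum.elim (fun x => x) fun p => p.1.1 p.2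
  let S : (Fin (2 ^ m) → ℂ) →ₗ[ℂ] H := Fintype.linearCombination ℂ fun i : Fin (2 ^ m) => b i
  let L : (Fin (2 ^ m) → ℂ) →ₗ[ℂ] (F ⊕ (Y × Fin m) → ℂ) :=
    LinearMap.pi fun p => (innerₛₗ ℂ (c p)).comp S
  obtain ⟨z, hz, hz0⟩ := Submodule.exists_mem_ne_zero_of_ne_bot
    (LinearMap.ker_ne_bot_of_finrank_lt (f := L) (by simpa using hm))
  have hS : S z ≠ 0 := by
    have hli : LinearIndependent ℂ fun i : Fin (2 ^ m) => b i :=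
      b.orthonormal.linearIndependent.comp _ Fin.val_injective
    intro h
    refine hz0 (hli.fintypeLinearCombination_injective ?_)
    rw [map_zero]
    exact h
  have hL (p) : ⟪c p, S z⟫_ℂ = 0 := congrFun hz p
  have hperp {x : H} (hx : ⟪x, S z⟫_ℂ = 0) : ⟪x, (‖S z‖⁻¹ : ℂ) • S z⟫_ℂ = 0 := by
    rw [inner_smul_right, hx, mul_zero]
  refine ⟨(‖S z‖⁻¹ : ℂ) • S z, norm_smul_inv_norm hS, fun x hx => hperp (hL (.inl ⟨x, hx⟩)),
    fun y hy k => hperp ?_⟩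
  by_cases hk : k < m
  · exact hL (.inr (⟨y, hy⟩, ⟨k, hk⟩))
  · simp only [S, Fintype.linearCombination_apply, inner_sum, inner_smul_right]
    refine Finset.sum_eq_zero fun i _ => ?_
    rw [← inner_conj_symm, hY y hy k i (i.2.trans_le (Nat.pow_le_pow_right two_pos (by omega)))]
    simp

/-- An orthonormal sequence (when `1 ∈ O`) whose terms stay orthogonal under the operators in `O`,
and which is orthogonal to all sequences in `Y`. -/
theorem exists_adapted_seq [CompleteSpace H] (b : HilbertBasis ℕ ℂ H) (O : Finset (H →L[ℂ] H))
    (hO : ∀ g ∈ O, star g ∈ O) (Y : Finset (ℕ → H))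
    (hY : ∀ y ∈ Y, ∀ k, ∀ i < 2 ^ k, ⟪b i, y k⟫_ℂ = 0) :
    ∃ v : ℕ → H, (∀ k, ‖v k‖ = 1) ∧ (∀ g ∈ O, ∀ k l, k ≠ l → ⟪v k, g (v l)⟫_ℂ = 0) ∧
      (∀ g ∈ O, ∀ k, ∀ i < 2 ^ k, ⟪b i, g (v k)⟫_ℂ = 0) ∧
      ∀ y ∈ Y, ∀ k l, ⟪v k, y l⟫_ℂ = 0 := by
  classical
  have hadj (g : H →L[ℂ] H) (x y : H) : ⟪x, g y⟫_ℂ = ⟪star g x, y⟫_ℂ :=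
    (g.adjoint_inner_left y x).symm
  obtain ⟨p, hp, hpr⟩ := exists_seq_of_forall_finset_exists
    (fun p : ℕ × H => ‖p.2‖ = 1 ∧ (∀ g ∈ O, ∀ i < 2 ^ p.1, ⟪b i, g p.2⟫_ℂ = 0) ∧
      ∀ y ∈ Y, ∀ l, ⟪y l, p.2⟫_ℂ = 0)
    (fun p q => p.1 < q.1 ∧ ∀ g ∈ O, ⟪g p.2, q.2⟫_ℂ = 0) (fun s _ => by
      let n := s.sup Prod.fst + 1
      obtain ⟨v, hv, hF, hvY⟩ := exists_unit_orthogonal b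
        (Finset.image₂ (fun g p => g p.2) O s ∪
          Finset.image₂ (fun g i => g (b i)) O (Finset.range (2 ^ n))) Y hY
      refine ⟨(n, v), ⟨hv, fun g hg i hi => ?_, hvY⟩, fun p hps => ⟨?_, fun g hg => ?_⟩⟩
      · rw [hadj]
        exact hF _ (Finset.mem_union_right _
          (Finset.mem_image₂_of_mem (hO g hg) (Finset.mem_range.2 hi)))
      · exact Nat.lt_succ_of_le (Finset.le_sup (f := Prod.fst) hps)
      · exact hF _ (Finset.mem_union_left _ (Finset.mem_image₂_of_mem hg hps)))
  have hmono : StrictMono fun k => (p k).1 := fun k l h => (hpr k l h).1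
  refine ⟨fun k => (p k).2, fun k => (hp k).1, fun g hg k l hkl => ?_, fun g hg k i hi => ?_,
    fun y hy k l => ?_⟩
  · rcases hkl.lt_or_gt with h | h
    · rw [hadj]
      exact (hpr k l h).2 _ (hO g hg)
    · rw [← inner_conj_symm, (hpr l k h).2 g hg, map_zero]
  · exact (hp k).2.1 g hg i (hi.trans_le (Nat.pow_le_pow_right two_pos (hmono.le_apply)))
  · rw [← inner_conj_symm, (hp k).2.2 y hy l, map_zero]

end Sequences

section Family

open scoped InnerProductSpace

variable {H : Type*} [NormedAddCommGroup H] [InnerProductSpace ℂ H] [CompleteSpace H]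

theorem exists_seq_family {X : Type*} (b : HilbertBasis ℕ ℂ H) (O : Finset X → Finset (H →L[ℂ] H))
    (hO : ∀ S, ∀ g ∈ O S, star g ∈ O S) :
    ∃ v : Finset X → ℕ → H, (∀ S k, ‖v S k‖ = 1) ∧
      (∀ S, ∀ g ∈ O S, ∀ k l, k ≠ l → ⟪v S k, g (v S l)⟫_ℂ = 0) ∧
      ∀ S T, T ⊂ S → ∀ g ∈ O T, ∀ k l, ⟪v S k, g (v T l)⟫_ℂ = 0 := by
  classical
  let P (S : Finset X) (w : ℕ → H) : Prop := (∀ k, ‖w k‖ = 1) ∧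
    (∀ g ∈ O S, ∀ k l, k ≠ l → ⟪w k, g (w l)⟫_ℂ = 0) ∧
    ∀ g ∈ O S, ∀ k, ∀ i < 2 ^ k, ⟪b i, g (w k)⟫_ℂ = 0
  have step (S : Finset X) (ih : ∀ T ⊂ S, {w // P T w}) : ∃ w, P S w ∧
      ∀ T (hT : T ⊂ S), ∀ g ∈ O T, ∀ k l, ⟪w k, g ((ih T hT).1 l)⟫_ℂ = 0 := by
    obtain ⟨w, h1, h2, h3, h4⟩ := exists_adapted_seq b (O S) (hO S)
      (S.ssubsets.attach.biUnion fun T =>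
        (O T).image fun g l => g ((ih T (Finset.mem_ssubsets.1 T.2)).1 l)) (fun y hy => by
          simp only [Finset.mem_biUnion, Finset.mem_image] at hy
          obtain ⟨T, -, g, hg, rfl⟩ := hy
          exact (ih T _).2.2.2 g hg)
    refine ⟨w, ⟨h1, h2, h3⟩, fun T hT g hg => h4 _ ?_⟩
    simp only [Finset.mem_biUnion, Finset.mem_image]
    exact ⟨⟨T, Finset.mem_ssubsets.2 hT⟩, Finset.mem_attach _ _, g, hg, rfl⟩
  choose w hw hwT using step
  let v : ∀ S, {w // P S w} := Finset.strongInduction fun S ih => ⟨w S ih, hw S ih⟩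
  refine ⟨fun S => v S, fun S => (v S).2.1, fun S => (v S).2.2.1, fun S T hT => ?_⟩
  have hv : (v S : ℕ → H) = w S fun T _ => v T := by
    simp only [v]
    rw [Finset.strongInduction_eq]
  simp only [hv]
  exact hwT S _ T hT

/-- The family of isometries used to build two orthogonal fields of isometries which are almost
`f`-orthogonal to each other. -/
theorem exists_isometry_family {X : Type*} (b : HilbertBasis ℕ ℂ H) (u : X → H →L[ℂ] H) :
    ∃ (V : Finset X → H →L[ℂ] H) (D E : H →L[ℂ] H), IsOrthPair D (star D) E (star E) ∧
      (∀ S, star (V S) * V S = 1) ∧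
      (∀ S, ∀ α ∈ S, star E * (star (V S) * u α * V S) * D = 0) ∧
      ∀ S T, T ⊂ S ∨ S ⊂ T → star (V S) * V T = 0 ∧
        ∀ α ∈ S, α ∈ T → star (V S) * u α * V T = 0 := by
  classical
  let O (S : Finset X) : Finset (H →L[ℂ] H) := insert 1 (S.image u ∪ S.image fun α => star (u α))
  have h1O (S) : 1 ∈ O S := Finset.mem_insert_self _ _
  have huO {S α} (h : α ∈ S) : u α ∈ O S :=
    Finset.mem_insert_of_mem (Finset.mem_union_left _ (Finset.mem_image_of_mem _ h))
  have hO (S) : ∀ g ∈ O S, star g ∈ O S := by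
    intro g hg
    simp only [O, Finset.mem_insert, Finset.mem_union, Finset.mem_image] at hg ⊢
    rcases hg with rfl | ⟨α, h, rfl⟩ | ⟨α, h, rfl⟩
    · simp
    · exact .inr (.inr ⟨α, h, rfl⟩)
    · exact .inr (.inl ⟨α, h, by simp⟩)
  obtain ⟨v, hv1, hv, hvT⟩ := exists_seq_family b O hO
  have hon (S) : Orthonormal ℂ (v S) := ⟨hv1 S, fun k l h => by simpa using hv S 1 (h1O S) k l h⟩
  choose V hVb hVV using fun S => exists_isometry b (hon S)
  obtain ⟨D, hDb, hDD⟩ := exists_isometry b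
    (b.orthonormal.comp (fun k => 2 * k) fun k l h => by simpa using h)
  obtain ⟨E, hEb, hEE⟩ := exists_isometry b
    (b.orthonormal.comp (fun k => 2 * k + 1) fun k l h => by simpa using h)
  have hne (k l : ℕ) : 2 * k ≠ 2 * l + 1 := by omega
  have hDE : star D * E = 0 := by
    simpa using star_mul_mul_eq_zero b (V := D) (G := 1) (W := E) fun k l => by
      simpa [hDb, hEb] using b.orthonormal.2 (hne k l)
  have hlt (S T) (h : T ⊂ S) (g) (hg : g ∈ O T) : star (V S) * g * V T = 0 :=
    star_mul_mul_eq_zero b fun k l => by simpa [hVb] using hvT S T h g hg k l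
  have hgt (S T) (h : S ⊂ T) (g) (hg : g ∈ O S) : star (V S) * g * V T = 0 := by
    simpa [mul_assoc] using congrArg star (hlt T S h _ (hO S g hg))
  refine ⟨V, D, E, ⟨hDD, hEE, hDE, by simpa using congrArg star hDE⟩, hVV, fun S α hα => ?_,
    fun S T h => ⟨?_, fun α hS hT => ?_⟩⟩
  · have := star_mul_mul_eq_zero b (V := V S * E) (G := u α) (W := V S * D) fun k l => by
      simpa [hVb, hDb, hEb] using hv S _ (huO hα) _ _ (hne l k).symm
    simpa [mul_assoc] using this
  · rcases h with h | h
    · simpa using hlt S T h 1 (h1O T)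
    · simpa using hgt S T h 1 (h1O S)
  · rcases h with h | h
    · exact hlt S T h _ (huO hT)
    · exact hgt S T h _ (huO hS)

end Family

section Weights

variable {X : Type*} [TopologicalSpace X] [NormalSpace X] [ParacompactSpace X]

/-- Weights indexed by the simplices of the nerve of an open cover (as in its barycentric
subdivision): the simplices that are active at a given point form a chain. -/
theorem exists_chain_weights {U : X → Set X} (hU : ∀ α, IsOpen (U α)) (hxU : ∀ x, x ∈ U x) :
    ∃ w : Finset X → X → ℝ, (∀ S, Continuous (w S)) ∧
      LocallyFinite (fun S => Function.support (w S)) ∧ (∀ x, ∃ S, w S x ≠ 0) ∧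
      (∀ S x, w S x ≠ 0 → S.Nonempty ∧ ∀ α ∈ S, x ∈ U α) ∧
      ∀ S T x, w S x ≠ 0 → w T x ≠ 0 → S ⊆ T ∨ T ⊆ S := by
  classical
  obtain ⟨φ, hφ⟩ := PartitionOfUnity.exists_isSubordinate isClosed_univ U hU
    fun x _ => Set.mem_iUnion.2 ⟨x, hxU x⟩
  have hle (S x) : ∑ α ∈ S, φ α x ≤ 1 := by
    rw [← φ.sum_finsupport' (Set.mem_univ x) (Finset.subset_union_right (s₁ := S))]
    exact Finset.sum_le_sum_of_subset_of_nonneg Finset.subset_union_left fun α _ _ => φ.nonneg α x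
  let w (S : Finset X) (x : X) : ℝ := (∑ α ∈ S, φ α x) *
    ∏ α ∈ S, max 0 (φ α x - (1 - ∑ β ∈ S, φ β x))
  have hw {S x} (h : w S x ≠ 0) {α} (hα : α ∈ S) : 1 - ∑ β ∈ S, φ β x < φ α x := by
    have := Finset.prod_ne_zero_iff.1 (right_ne_zero_of_mul h) α hα
    by_contra hlt
    exact this (max_eq_left (by linarith))
  have hpos {S x} (h : w S x ≠ 0) {α} (hα : α ∈ S) : φ α x ≠ 0 := by
    have := hw h hα
    have := hle S x
    linarith
  have hout {S : Finset X} {α} (hα : α ∉ S) (x) : φ α x ≤ 1 - ∑ β ∈ S, φ β x := by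
    have := hle (insert α S) x
    rw [Finset.sum_insert hα] at this
    linarith
  refine ⟨w, fun S => ?_, fun x => ?_, fun x => ⟨φ.finsupport x, ?_⟩,
    fun S x h => ⟨?_, fun α hα => ?_⟩,
    fun S T x hS hT => ?_⟩
  · have (α : X) : Continuous (φ α) := (φ α).continuous
    fun_prop
  · refine ⟨_, φ.eventually_finsupport_subset x, (φ.fintsupport x).powerset.finite_toSet.subset ?_⟩
    rintro S ⟨y, hy, hyx⟩
    simp only [Finset.coe_powerset, Set.mem_preimage, Set.mem_powerset_iff, Finset.coe_subset]
    exact fun α hα => hyx ((φ.mem_finsupport y).2 (hpos hy hα))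
  · have h1 := φ.sum_finsupport (Set.mem_univ x)
    simp only [w, h1, one_mul, sub_self, sub_zero]
    refine Finset.prod_ne_zero_iff.2 fun α hα => ?_
    have := (φ.mem_finsupport x).1 hα
    rwa [max_eq_right (φ.nonneg α x)]
  · rw [Finset.nonempty_iff_ne_empty]
    rintro rfl
    simp [w] at h
  · exact hφ α (subset_tsupport _ (hpos h hα))
  · by_contra! hST
    obtain ⟨α, hαS, hαT⟩ := Finset.not_subset.1 hST.1
    obtain ⟨β, hβT, hβS⟩ := Finset.not_subset.1 hST.2
    linarith [hw hS hαS, hw hT hβT, hout hαT x, hout hβS x]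

theorem exists_normalized_chain_weights {U : X → Set X} (hU : ∀ α, IsOpen (U α))
    (hxU : ∀ x, x ∈ U x) :
    ∃ w : Finset X → X → ℝ, (∀ S, Continuous (w S)) ∧
      LocallyFinite (fun S => Function.support (w S)) ∧ (∀ x, ∑ᶠ S, w S x ^ 2 = 1) ∧
      (∀ S x, w S x ≠ 0 → S.Nonempty ∧ ∀ α ∈ S, x ∈ U α) ∧
      ∀ S T x, w S x ≠ 0 → w T x ≠ 0 → S ⊆ T ∨ T ⊆ S := by
  obtain ⟨w, hw, hlf, hne, hwU, hchain⟩ := exists_chain_weights hU hxU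
  have hlf2 : LocallyFinite fun S => Function.support fun x => w S x ^ 2 :=
    hlf.subset fun S x hx h => hx (by simp [h])
  let N (x : X) : ℝ := ∑ᶠ S, w S x ^ 2
  have hN : Continuous N := continuous_finsum (fun S => (hw S).pow 2) hlf2
  have hNpos (x) : 0 < N x := by
    obtain ⟨S, hS⟩ := hne x
    exact finsum_pos (fun S => sq_nonneg _) ⟨S, by positivity⟩ (hlf2.point_finite x)
  have hN0 (x) := (Real.sqrt_pos.2 (hNpos x)).ne'
  refine ⟨fun S x => (√(N x))⁻¹ * w S x, fun S => (hN.sqrt.inv₀ hN0).mul (hw S),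
    hlf.subset fun S x hx => right_ne_zero_of_mul hx, fun x => ?_,
    fun S x h => hwU S x (right_ne_zero_of_mul h),
    fun S T x hS hT => hchain S T x (right_ne_zero_of_mul hS) (right_ne_zero_of_mul hT)⟩
  simp only [mul_pow, ← mul_finsum]
  rw [inv_pow, Real.sq_sqrt (hNpos x).le]
  exact inv_mul_cancel₀ (hNpos x).ne'

end Weights

section Fields

variable {H : Type*} [NormedAddCommGroup H] [InnerProductSpace ℂ H] [CompleteSpace H]

theorem norm_le_one_of_star_mul_self {a : H →L[ℂ] H} (h : star a * a = 1) : ‖a‖ ≤ 1 := by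
  have h1 := CStarRing.norm_star_mul_self (x := a)
  rw [h] at h1
  have h2 : ‖(1 : H →L[ℂ] H)‖ ≤ 1 := ContinuousLinearMap.norm_id_le
  nlinarith [norm_nonneg a]

theorem star_sum_mul_mul_sum {A ι : Type*} [Ring A] [StarRing A] [Algebra ℝ A] [StarModule ℝ A]
    (F : Finset ι) (c : ι → ℝ) (V : ι → A) (u : A) :
    star (∑ S ∈ F, c S • V S) * u * (∑ S ∈ F, c S • V S) =
      ∑ S ∈ F, ∑ T ∈ F, (c S * c T) • (star (V S) * u * V T) := by
  rw [star_sum, Finset.sum_mul, Finset.sum_mul_sum]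
  simp only [star_smul, star_trivial, smul_mul_assoc, mul_smul_comm, smul_smul, mul_comm]

/-- Two orthogonal fields of isometries `A`, `B` such that `f * A` is far from the range of `B`. -/
theorem exists_orth_fields {X : Type*} [TopologicalSpace X] [NormalSpace X] [ParacompactSpace X]
    (b : HilbertBasis ℕ ℂ H) {f : X → H →L[ℂ] H} (hf : Continuous f) :
    ∃ A B : X → H →L[ℂ] H, Continuous A ∧ Continuous B ∧
      (∀ x, IsOrthPair (A x) (star (A x)) (B x) (star (B x))) ∧
      ∀ x, ‖star (B x) * f x * A x‖ < 1 := by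
  obtain ⟨V, D, E, hDE, hV, hVu, hVT⟩ := exists_isometry_family b f
  obtain ⟨w, hw, hlf, hw1, hwU, hchain⟩ := exists_normalized_chain_weights
    (U := fun α => {x | ‖f x - f α‖ < 1})
    (fun α => isOpen_lt (by fun_prop) continuous_const) (fun x => by simp)
  let W (x : X) : H →L[ℂ] H := ∑ᶠ S, w S x • V S
  have hW : Continuous W := continuous_finsum (fun S => (hw S).smul continuous_const)
    (hlf.subset fun S x hx h => hx (by simp [h]))
  let F (x : X) : Finset (Finset X) := (hlf.point_finite x).toFinset
  have hF {x S} : S ∈ F x ↔ w S x ≠ 0 := by simp [F]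
  have hWF (x) : W x = ∑ S ∈ F x, w S x • V S :=
    finsum_eq_sum_of_support_subset _ fun S hS => by
      rw [Finset.mem_coe, hF]
      exact fun h => hS (by simp [h])
  have hcmp {x S T} (hS : S ∈ F x) (hT : T ∈ F x) (hST : S ≠ T) : T ⊂ S ∨ S ⊂ T := by
    rcases hchain S T x (hF.1 hS) (hF.1 hT) with h | h
    · exact .inr (h.ssubset_of_ne hST)
    · exact .inl (h.ssubset_of_ne hST.symm)
  have hsum (x) : ∑ S ∈ F x, w S x * w S x = 1 := by
    rw [← hw1 x, finsum_eq_sum_of_support_subset (s := F x)]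
    · simp only [sq]
    · intro S hS
      rw [Finset.mem_coe, hF]
      exact fun h => hS (by simp [h])
  have hWW (x) : star (W x) * W x = 1 := by
    have := star_sum_mul_mul_sum (F x) (fun S => w S x) V 1
    simp only [mul_one, ← hWF] at this
    have h1 : ∑ S ∈ F x, (w S x * w S x) • (1 : H →L[ℂ] H) = 1 := by
      rw [← Finset.sum_smul, hsum, one_smul]
    rw [this, ← h1]
    refine Finset.sum_congr rfl fun S hS => ?_
    rw [Finset.sum_eq_single_of_mem S hS fun T hT hTS => by
      rw [(hVT S T (hcmp hS hT hTS.symm)).1, smul_zero], hV]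
  have hWu (x) : ∃ α, ‖f x - f α‖ < 1 ∧ star E * (star (W x) * f α * W x) * D = 0 := by
    have hne : (F x).Nonempty := by
      rw [Finset.nonempty_iff_ne_empty]
      intro h
      simpa [h] using hsum x
    obtain ⟨S₀, hS₀, hmin⟩ := (F x).exists_min_image Finset.card hne
    obtain ⟨⟨α, hα⟩, hU⟩ := hwU S₀ x (hF.1 hS₀)
    have hmem {S} (hS : S ∈ F x) : α ∈ S := by
      rcases hchain S₀ S x (hF.1 hS₀) (hF.1 hS) with h | h
      · exact h hα
      · rwa [Finset.eq_of_subset_of_card_le h (hmin S hS)]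
    refine ⟨α, hU α hα, ?_⟩
    rw [hWF, star_sum_mul_mul_sum, Finset.mul_sum, Finset.sum_mul]
    refine Finset.sum_eq_zero fun S hS => ?_
    rw [Finset.mul_sum, Finset.sum_mul]
    refine Finset.sum_eq_zero fun T hT => ?_
    rw [mul_smul_comm, smul_mul_assoc]
    by_cases hST : S = T
    · subst hST
      rw [hVu S α (hmem hS), smul_zero]
    · rw [(hVT S T (hcmp hS hT hST)).2 α (hmem hS) (hmem hT)]
      simp
  have hW' (x) (z : H →L[ℂ] H) : star (W x) * (W x * z) = z := by rw [← mul_assoc, hWW, one_mul]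
  have hpair (x) : IsOrthPair (W x * D) (star (W x * D)) (W x * E) (star (W x * E)) := by
    constructor <;> simp [mul_assoc, hW', hDE.ss, hDE.tt, hDE.st, hDE.ts]
  refine ⟨fun x => W x * D, fun x => W x * E, by fun_prop, by fun_prop, hpair, fun x => ?_⟩
  obtain ⟨α, hα, h0⟩ := hWu x
  have key : star (W x * E) * f x * (W x * D) = star (W x * E) * (f x - f α) * (W x * D) := by
    have : star (W x * E) * f α * (W x * D) = 0 := by simpa [mul_assoc] using h0
    rw [mul_sub, sub_mul, this, sub_zero]
  rw [key]
  have hA := norm_le_one_of_star_mul_self (hpair x).ss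
  have hB := norm_le_one_of_star_mul_self (hpair x).tt
  rw [← norm_star] at hB
  calc ‖star (W x * E) * (f x - f α) * (W x * D)‖
      ≤ ‖star (W x * E)‖ * ‖f x - f α‖ * ‖W x * D‖ := norm_mul₃_le
    _ ≤ 1 * ‖f x - f α‖ * 1 := by gcongr
    _ < 1 := by simpa using hα

end Fields

section Unitary

variable {H : Type*} [NormedAddCommGroup H] [InnerProductSpace ℂ H] [CompleteSpace H]

theorem homotopic_one_of_unitary {X : Type*} [TopologicalSpace X] [NormalSpace X]
    [ParacompactSpace X] (b : HilbertBasis ℕ ℂ H) (f : C(X, (H →L[ℂ] H)ˣ))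
    (hf : ∀ x, (f x : H →L[ℂ] H) ∈ unitary (H →L[ℂ] H)) : f.Homotopic 1 := by
  have hfc : Continuous fun x => (f x : H →L[ℂ] H) := continuous_val f
  obtain ⟨A, B, hA, hB, hAB, hlt⟩ := exists_orth_fields b hfc
  let P (x : X) : H →L[ℂ] H := B x * (star (B x) * f x * A x) * star (A x)
  have hP : Continuous P := by fun_prop
  have hPlt (x) : ‖P x‖ < 1 := by
    have h1 := norm_le_one_of_star_mul_self (hAB x).ss
    have h2 := norm_le_one_of_star_mul_self (hAB x).tt
    rw [← norm_star] at h1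
    calc ‖P x‖ ≤ ‖B x‖ * ‖star (B x) * f x * A x‖ * ‖star (A x)‖ := norm_mul₃_le
      _ ≤ 1 * ‖star (B x) * f x * A x‖ * 1 := by gcongr
      _ < 1 := by simpa using hlt x
  let h (p : I × X) : H →L[ℂ] H := f p.2 - (p.1 : ℝ) • P p.2
  have hc : Continuous h := by fun_prop
  have hunit (p) : IsUnit (h p) := by
    have hmul : h p = f p.2 * (1 - (p.1 : ℝ) • (star (f p.2 : H →L[ℂ] H) * P p.2)) := by
      rw [mul_sub, mul_one, mul_smul_comm, ← mul_assoc, (Unitary.mem_iff.1 (hf p.2)).2, one_mul]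
    rw [hmul]
    refine (f p.2).isUnit.mul (isUnit_one_sub_of_norm_lt_one ?_)
    have h1 := norm_le_one_of_star_mul_self (Unitary.mem_iff.1 (hf p.2)).1
    rw [← norm_star] at h1
    calc ‖(p.1 : ℝ) • (star (f p.2 : H →L[ℂ] H) * P p.2)‖
        ≤ ‖(p.1 : ℝ)‖ * (‖star (f p.2 : H →L[ℂ] H)‖ * ‖P p.2‖) := by
          rw [norm_smul]
          gcongr
          exact norm_mul_le _ _
      _ ≤ 1 * (1 * ‖P p.2‖) := by
          gcongr
          rw [Real.norm_of_nonneg p.1.2.1]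
          exact p.1.2.2
      _ < 1 := by simpa using hPlt p.2
  let g : C(X, (H →L[ℂ] H)ˣ) := ⟨fun x => (hunit (1, x)).unit,
    Units.isOpenEmbedding_val.isEmbedding.continuous_iff.2 (hc.comp (Continuous.prodMk_right 1))⟩
  have hfg : f.Homotopic g := homotopic_of_isUnit h hc hunit (fun x => by simp [h])
    (fun x => by simp [g])
  obtain ⟨v, v', w, w', Φ, hΦ⟩ := exists_isAmplification b
  refine hfg.trans (homotopic_one_of_orth hΦ hA hA.star hB hB.star hAB g fun x => ?_)
  have hBB (z : H →L[ℂ] H) : star (B x) * (B x * z) = z := (hAB x).tt_assoc z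
  simp [g, h, P, mul_sub, sub_mul, mul_assoc, hBB, (hAB x).ss]

end Unitary

end Kuiper

/-- For an infinite-dimensional separable complex Hilbert space `H`, the group of unitary
operators on `H` is contractible in the operator-norm topology (Kuiper's theorem). -/
theorem unitary_contractible_of_infinite_dimensional
    (H : Type*) [NormedAddCommGroup H] [InnerProductSpace ℂ H] [CompleteSpace H]
    [TopologicalSpace.SeparableSpace H] (hH : ¬ FiniteDimensional ℂ H) :
    ContractibleSpace (unitary (H →L[ℂ] H)) := by
  obtain ⟨b⟩ := Kuiper.exists_hilbertBasis_nat hH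
  obtain ⟨r, hr⟩ := Kuiper.exists_unitary_retraction (A := H →L[ℂ] H)
  let f : C(unitary (H →L[ℂ] H), (H →L[ℂ] H)ˣ) := ⟨fun u => Unitary.toUnits u,
    Units.continuous_iff.2 ⟨continuous_subtype_val, continuous_subtype_val.star⟩⟩
  have hf : f.Homotopic 1 := Kuiper.homotopic_one_of_unitary b f fun u => u.2
  have hid : r.comp f = ContinuousMap.id _ := ContinuousMap.ext hr
  rw [contractible_iff_id_nullhomotopic, ← hid]
  exact ⟨r 1, (ContinuousMap.Homotopic.refl r).comp hf⟩
end

section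
/- Let H be a complex Hilbert space, ι an index type, and l a filter on ι. Let (U_i) be a family of unitary operators on H and U₀ a unitary operator on H such that, for every ξ ∈ H, U_i ξ converges to U₀ ξ along l (strong convergence). Let (T_i) be a family of bounded operators on H converging along l in the operator norm to a compact operator T₀. Then U_i ∘ T_i converges to U₀ ∘ T₀ along l in the operator norm. -/
open Filter

/-- A bounded family of operators converging strongly becomes norm convergent after composition
on the right with a compact operator. -/
theorem IsCompactOperator.tendsto_comp_of_tendsto_apply
    {𝕜 E F G ι : Type*} [RCLike 𝕜]
    [NormedAddCommGroup E] [NormedSpace 𝕜 E] [NormedAddCommGroup F] [NormedSpace 𝕜 F]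
    [NormedAddCommGroup G] [NormedSpace 𝕜 G] {l : Filter ι}
    {T : E →L[𝕜] F} (hT : IsCompactOperator T) {A : ι → F →L[𝕜] G} {A₀ : F →L[𝕜] G} {C : ℝ}
    (hA : ∀ i, ‖A i‖ ≤ C) (hlim : ∀ y, Tendsto (fun i => A i y) l (nhds (A₀ y))) :
    Tendsto (fun i => (A i).comp T) l (nhds (A₀.comp T)) := by
  obtain ⟨K, hK, hTK⟩ := hT.image_closedBall_subset_compact (f := (T : E →ₛₗ[RingHom.id 𝕜] F)) 1
  rw [Metric.tendsto_nhds]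
  intro ε hε
  set D : ℝ := |C| + ‖A₀‖ + 1
  have hD : 0 < D := by positivity
  have hAD (i : ι) : ‖A i - A₀‖ ≤ D := by
    linarith [norm_sub_le (A i) A₀, hA i, le_abs_self C]
  obtain ⟨t, -, ht, hKt⟩ := hK.finite_cover_balls (e := ε / (4 * D)) (by positivity)
  have hnet : ∀ᶠ i in l, ∀ y ∈ t, dist (A i y) (A₀ y) < ε / 4 :=
    (ht.eventually_all).2 fun y _ => Metric.tendsto_nhds.1 (hlim y) _ (by positivity)
  filter_upwards [hnet] with i hi
  rw [dist_eq_norm]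
  refine lt_of_le_of_lt (ContinuousLinearMap.opNorm_le_of_unit_norm (C := ε / 2)
    (by positivity) fun x hx => ?_) (half_lt_self hε)
  have hxK : T x ∈ K := hTK ⟨x, by simp [hx], rfl⟩
  obtain ⟨y, hy, hxy⟩ := Set.mem_iUnion₂.1 (hKt hxK)
  rw [Metric.mem_ball, dist_eq_norm] at hxy
  have hyi := hi y hy
  rw [dist_eq_norm] at hyi
  calc ‖((A i).comp T - A₀.comp T) x‖
      = ‖(A i - A₀) (T x - y) + (A i y - A₀ y)‖ := by
        congr 1
        simp only [sub_apply, ContinuousLinearMap.comp_apply, map_sub]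
        abel
    _ ≤ ‖(A i - A₀) (T x - y)‖ + ‖A i y - A₀ y‖ := norm_add_le _ _
    _ ≤ D * (ε / (4 * D)) + ε / 4 := by
        gcongr
        exact (A i - A₀).le_of_opNorm_le_of_le (hAD i) hxy.le
    _ = ε / 2 := by field_simp; ring

/-- If a family of unitaries `U i` on a complex Hilbert space converges strongly to a
unitary `U₀`, and `T i` converges in operator norm to a compact operator `T₀`, then
`U i ∘ T i` converges in operator norm to `U₀ ∘ T₀`. -/
theorem tendsto_unitary_comp_compact
    {H : Type*} [NormedAddCommGroup H] [InnerProductSpace ℂ H] [CompleteSpace H]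
    {ι : Type*} {l : Filter ι}
    (U : ι → H →L[ℂ] H) (U₀ : H →L[ℂ] H)
    (hU : ∀ i, U i ∈ unitary (H →L[ℂ] H)) (hU₀ : U₀ ∈ unitary (H →L[ℂ] H))
    (hstrong : ∀ ξ : H, Tendsto (fun i => U i ξ) l (nhds (U₀ ξ)))
    (T : ι → H →L[ℂ] H) (T₀ : H →L[ℂ] H)
    (hT : Tendsto T l (nhds T₀)) (hcpt : IsCompactOperator T₀) :
    Tendsto (fun i => (U i).comp (T i)) l (nhds (U₀.comp T₀)) := by
  have hnorm (i : ι) : ‖U i‖ ≤ 1 := by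
    rw [← mul_one (U i), CStarRing.norm_mem_unitary_mul 1 (hU i)]
    exact ContinuousLinearMap.norm_id_le
  have hfixed := hcpt.tendsto_comp_of_tendsto_apply hnorm hstrong
  have hdiff : Tendsto (fun i => (U i).comp (T i - T₀)) l (nhds 0) := by
    refine squeeze_zero_norm (fun i => ?_) (tendsto_iff_norm_sub_tendsto_zero.1 hT)
    calc ‖(U i).comp (T i - T₀)‖ ≤ ‖U i‖ * ‖T i - T₀‖ := ContinuousLinearMap.opNorm_comp_le _ _
      _ ≤ ‖T i - T₀‖ := mul_le_of_le_one_left (norm_nonneg _) (hnorm i)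
  simpa [ContinuousLinearMap.comp_sub] using hdiff.add hfixed
end

section
/- Let H be a complex Hilbert space, ι an index type, and l a filter on ι. Let (U_i) be a family of unitary operators on H and U₀ a unitary operator such that, for every ξ ∈ H, both U_i ξ → U₀ ξ and U_i* ξ → U₀* ξ along l (*-strong convergence). Let (T_i) be a family of bounded operators on H converging along l in the operator norm to a compact operator T₀. Then U_i ∘ T_i ∘ U_i* converges to U₀ ∘ T₀ ∘ U₀* along l in the operator norm. -/
open Filter

/-- A bounded net of operators converging strongly to `0` converges to `0` in norm after
composition with a compact operator on the right. -/
theorem tendsto_comp_isCompactOperator_zero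
    {𝕜 E F G : Type*} [RCLike 𝕜] [NormedAddCommGroup E] [NormedSpace 𝕜 E]
    [NormedAddCommGroup F] [NormedSpace 𝕜 F] [NormedAddCommGroup G] [NormedSpace 𝕜 G]
    {ι : Type*} {l : Filter ι} {D : ι → F →L[𝕜] G} {C : ℝ} (hC : ∀ i, ‖D i‖ ≤ C)
    (hD : ∀ x, Tendsto (fun i => D i x) l (nhds 0))
    {K : E →L[𝕜] F} (hK : IsCompactOperator K) :
    Tendsto (fun i => (D i).comp K) l (nhds 0) := by
  rw [Metric.tendsto_nhds]
  intro ε hε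
  obtain ⟨S, hS, hKS⟩ := hK.image_closedBall_subset_compact (𝕜₁ := 𝕜) (f := K.toLinearMap) 1
  have hδ : 0 < ε / (4 * (|C| + 1)) := by positivity
  obtain ⟨t, -, ht, hcov⟩ := hS.finite_cover_balls hδ
  have hev : ∀ᶠ i in l, ∀ y ∈ t, ‖D i y‖ < ε / 4 := by
    rw [ht.eventually_all]
    intro y _
    simpa using (Metric.tendsto_nhds.1 (hD y)) (ε / 4) (by positivity)
  filter_upwards [hev] with i hi
  rw [dist_zero_right]
  refine lt_of_le_of_lt ?_ (half_lt_self hε)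
  refine ContinuousLinearMap.opNorm_le_of_unit_norm (by positivity) fun x hx => ?_
  have hxS : K x ∈ S := hKS ⟨x, by simpa using hx.le, rfl⟩
  obtain ⟨y, hy, hxy⟩ := Set.mem_iUnion₂.1 (hcov hxS)
  rw [Metric.mem_ball, dist_eq_norm] at hxy
  have hfar : ‖D i (K x - y)‖ ≤ ε / 4 := by
    calc ‖D i (K x - y)‖ ≤ ‖D i‖ * ‖K x - y‖ := (D i).le_opNorm _
      _ ≤ (|C| + 1) * (ε / (4 * (|C| + 1))) := by
        gcongr
        linarith [hC i, le_abs_self C]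
      _ = ε / 4 := by field_simp
  calc ‖D i (K x)‖ = ‖D i (K x - y) + D i y‖ := by simp
    _ ≤ ‖D i (K x - y)‖ + ‖D i y‖ := norm_add_le _ _
    _ ≤ ε / 2 := by linarith [hi y hy]

/-- If a bounded net of operators on a Hilbert space converges strongly to `0`, then composing
a compact operator with their adjoints gives a net converging to `0` in norm. -/
theorem IsCompactOperator.tendsto_mul_star_zero
    {𝕜 H : Type*} [RCLike 𝕜] [NormedAddCommGroup H] [InnerProductSpace 𝕜 H] [CompleteSpace H]
    {ι : Type*} {l : Filter ι} {D : ι → H →L[𝕜] H} {C : ℝ} (hC : ∀ i, ‖D i‖ ≤ C)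
    (hD : ∀ x, Tendsto (fun i => D i x) l (nhds 0))
    {K : H →L[𝕜] H} (hK : IsCompactOperator K) :
    Tendsto (fun i => K * star (D i)) l (nhds 0) := by
  have hcomp : Tendsto (fun i => D i * (star K * K)) l (nhds 0) :=
    tendsto_comp_isCompactOperator_zero hC hD (hK.clm_comp (star K))
  have hsq : Tendsto (fun i => ‖K * star (D i)‖ ^ 2) l (nhds 0) := by
    refine squeeze_zero (fun i => by positivity) (fun i => ?_)
      (by simpa using hcomp.norm.mul_const C)
    calc ‖K * star (D i)‖ ^ 2 = ‖D i * (star K * K) * star (D i)‖ := by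
          rw [sq, ← CStarRing.norm_star_mul_self]
          simp [mul_assoc]
      _ ≤ ‖D i * (star K * K)‖ * ‖star (D i)‖ := norm_mul_le _ _
      _ ≤ ‖D i * (star K * K)‖ * C := by
          gcongr
          exact (norm_star (D i)).trans_le (hC i)
  rw [tendsto_zero_iff_norm_tendsto_zero]
  simpa using hsq.sqrt

/-- If a family of unitaries `U i` on a complex Hilbert space converges *-strongly to a
unitary `U₀` (i.e. both `U i ξ → U₀ ξ` and `(U i)* ξ → U₀* ξ` for all `ξ`), and `T i`
converges in operator norm to a compact operator `T₀`, then `U i ∘ T i ∘ (U i)*`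
converges in operator norm to `U₀ ∘ T₀ ∘ U₀*`. -/
theorem tendsto_unitary_conj_compact
    {H : Type*} [NormedAddCommGroup H] [InnerProductSpace ℂ H] [CompleteSpace H]
    {ι : Type*} {l : Filter ι}
    (U : ι → H →L[ℂ] H) (U₀ : H →L[ℂ] H)
    (hU : ∀ i, U i ∈ unitary (H →L[ℂ] H)) (hU₀ : U₀ ∈ unitary (H →L[ℂ] H))
    (hstrong : ∀ ξ : H, Tendsto (fun i => U i ξ) l (nhds (U₀ ξ)))
    (hstrong_star : ∀ ξ : H, Tendsto (fun i => (star (U i)) ξ) l (nhds ((star U₀) ξ)))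
    (T : ι → H →L[ℂ] H) (T₀ : H →L[ℂ] H)
    (hT : Tendsto T l (nhds T₀)) (hcpt : IsCompactOperator T₀) :
    Tendsto (fun i => (U i).comp ((T i).comp (star (U i)))) l
      (nhds (U₀.comp (T₀.comp (star U₀)))) := by
  have hU1 : ∀ i, ‖U i‖ ≤ 1 := fun i => by
    nontriviality H →L[ℂ] H
    exact (CStarRing.norm_of_mem_unitary (hU i)).le
  have hC : ∀ i, ‖U i - U₀‖ ≤ 1 + ‖U₀‖ := fun i =>
    (norm_sub_le _ _).trans (by gcongr; exact hU1 i)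
  have hD : ∀ x, Tendsto (fun i => (U i - U₀) x) l (nhds 0) := fun x => by
    simpa using (hstrong x).sub_const (U₀ x)
  have hleft : Tendsto (fun i => (U i - U₀) * T₀) l (nhds 0) :=
    tendsto_comp_isCompactOperator_zero hC hD hcpt
  have hright : Tendsto (fun i => T₀ * star (U i - U₀)) l (nhds 0) :=
    hcpt.tendsto_mul_star_zero hC hD
  have hmid : Tendsto (fun i => T i - T₀) l (nhds 0) := by simpa using hT.sub_const T₀
  rw [tendsto_iff_norm_sub_tendsto_zero]
  refine squeeze_zero (fun i => norm_nonneg _) (fun i => ?_)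
    (by simpa only [norm_zero, add_zero, zero_mul] using
      (hmid.norm.add hright.norm).add (hleft.norm.mul_const ‖star U₀‖))
  change ‖U i * (T i * star (U i)) - U₀ * (T₀ * star U₀)‖ ≤ _
  have hsplit : U i * (T i * star (U i)) - U₀ * (T₀ * star U₀) =
      U i * (T i - T₀) * star (U i) + U i * (T₀ * star (U i - U₀)) +
        (U i - U₀) * T₀ * star U₀ := by
    rw [star_sub]
    noncomm_ring
  rw [hsplit]
  refine (norm_add₃_le).trans ?_
  gcongr
  · rw [CStarRing.norm_mul_mem_unitary _ (Unitary.star_mem (hU i)),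
      CStarRing.norm_mem_unitary_mul _ (hU i)]
  · rw [CStarRing.norm_mem_unitary_mul _ (hU i)]
  · exact norm_mul_le _ _
end

section
/- Let X and Y be second countable, locally compact Hausdorff topological spaces and p : X → Y a continuous map. Then there exist a locally compact Hausdorff topological space Z, an open topological embedding j : X → Z, and a closed topological embedding i : Y → Z whose image is exactly the complement of j(X), together with a continuous proper map q : Z → Y satisfying q ∘ j = p and q ∘ i = id_Y. -/
universe u

open Topology in
/-- The union of the graph of `p` with the section at infinity is closed in `OnePoint X × Y`. -/
theorem isClosed_onePoint_graph {X Y : Type*} [TopologicalSpace X] [TopologicalSpace Y]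
    [T2Space Y] {p : X → Y} (hp : Continuous p) :
    IsClosed {w : OnePoint X × Y | ∀ x : X, (x : OnePoint X) = w.1 → p x = w.2} := by
  have hopen : IsOpen {w : X × Y | p w.1 ≠ w.2} :=
    isOpen_ne_fun (hp.comp continuous_fst) continuous_snd
  have himage := (OnePoint.isOpenEmbedding_coe (X := X)).prodMap
    (IsOpenEmbedding.id (X := Y)) |>.isOpenMap _ hopen
  rw [← isOpen_compl_iff]
  convert himage using 1
  ext ⟨z, y⟩
  simp only [Set.mem_compl_iff, Set.mem_ofPred_eq, Set.mem_image, Prod.exists, Prod.map_apply,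
    Prod.mk.injEq, id_eq, not_forall]
  constructor
  · rintro ⟨x, hx, hxy⟩
    exact ⟨x, y, hxy, hx, rfl⟩
  · rintro ⟨x, _, hxy, hx, rfl⟩
    exact ⟨x, hx, hxy⟩

/-- Fibrewise one-point compactification: for a continuous map `p : X → Y` between second
countable, locally compact Hausdorff spaces, there is a locally compact Hausdorff space `Z`,
an open embedding `j : X → Z`, a closed embedding `i : Y → Z` whose image is the complement
of `j(X)`, and a continuous proper map `q : Z → Y` with `q ∘ j = p` and `q ∘ i = id`. -/
theorem exists_fibrewise_compactification
    {X Y : Type u} [TopologicalSpace X] [SecondCountableTopology X]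
    [LocallyCompactSpace X] [T2Space X]
    [TopologicalSpace Y] [SecondCountableTopology Y] [LocallyCompactSpace Y] [T2Space Y]
    (p : X → Y) (hp : Continuous p) :
    ∃ (Z : Type u) (_ : TopologicalSpace Z), LocallyCompactSpace Z ∧ T2Space Z ∧
      ∃ (j : X → Z) (i : Y → Z) (q : Z → Y),
        Topology.IsOpenEmbedding j ∧ Topology.IsClosedEmbedding i ∧
        Set.range i = (Set.range j)ᶜ ∧
        Continuous q ∧ IsProperMap q ∧ q ∘ j = p ∧ q ∘ i = id := by
  have hclosed := isClosed_onePoint_graph hp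
  set S := {w : OnePoint X × Y | ∀ x : X, (x : OnePoint X) = w.1 → p x = w.2}
  let j : X → S := fun x => ⟨(x, p x), fun _ h => congrArg p (OnePoint.coe_injective h)⟩
  let i : Y → S := fun y => ⟨(OnePoint.infty, y), fun x h => (OnePoint.coe_ne_infty x h).elim⟩
  let q : S → Y := fun w => w.1.2
  have hj : Continuous j := (OnePoint.continuous_coe.prodMk hp).subtype_mk _
  have hi : Continuous i := (continuous_const.prodMk continuous_id).subtype_mk _
  have hfst : Continuous fun w : S => w.1.1 := continuous_fst.comp continuous_subtype_val
  have hq : IsProperMap q :=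
    isProperMap_snd_of_compactSpace.comp hclosed.isClosedEmbedding_subtypeVal.isProperMap
  have hrange : Set.range j = (fun w : S => w.1.1) ⁻¹' Set.range ((↑) : X → OnePoint X) := by
    ext ⟨⟨z, y⟩, hw⟩
    constructor
    · rintro ⟨x, hx⟩
      exact ⟨x, congrArg (fun w : S => w.1.1) hx⟩
    · rintro ⟨x, hx⟩
      exact ⟨x, Subtype.ext (Prod.ext hx (hw x hx))⟩
  refine ⟨S, inferInstance, hclosed.isClosedEmbedding_subtypeVal.locallyCompactSpace,
    inferInstance, j, i, q, ⟨?_, ?_⟩, ?_, ?_, hq.continuous, hq, rfl, rfl⟩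
  · exact .of_comp hj hfst OnePoint.isOpenEmbedding_coe.isEmbedding
  · exact hrange ▸ OnePoint.isOpen_range_coe.preimage hfst
  · exact Function.LeftInverse.isClosedEmbedding (f := q) (fun _ => rfl) hq.continuous hi
  · rw [hrange, ← Set.preimage_compl, OnePoint.compl_range_coe]
    ext ⟨⟨z, y⟩, hw⟩
    constructor
    · rintro ⟨y', hy⟩
      exact (congrArg (fun w : S => w.1.1) hy).symm
    · intro hz
      exact ⟨y, Subtype.ext (Prod.ext (Eq.symm hz) rfl)⟩
end

section
/- Let X and Y be second countable, locally compact Hausdorff topological spaces, let p : X → Y be continuous, and let A ⊆ X be a closed subset such that the restriction of p to A is a proper map. Then there exists an open set U ⊆ X with A ⊆ U such that the restriction of p to the closure of U is a proper map. -/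
open Set in
/-- A closed set on which a continuous map to a σ-compact, locally compact space is proper
has an open neighbourhood whose closure meets the preimage of each compact set in a
compact set. -/
lemma exists_isOpen_superset_isCompact_closure_inter_preimage
    {X Y : Type*} [TopologicalSpace X] [LocallyCompactSpace X] [R1Space X]
    [TopologicalSpace Y] [SigmaCompactSpace Y] [WeaklyLocallyCompactSpace Y] [T2Space Y]
    {p : X → Y} (hp : Continuous p) {A : Set X}
    (hA : ∀ K, IsCompact K → IsCompact (A ∩ p ⁻¹' K)) :
    ∃ U : Set X, IsOpen U ∧ A ⊆ U ∧ ∀ K, IsCompact K → IsCompact (closure U ∩ p ⁻¹' K) := by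
  set K := (CompactExhaustion.choice Y).shiftr.shiftr
  have hlayer (n : ℕ) : ∃ V, IsCompact V ∧
      A ∩ p ⁻¹' (K (n + 2) \ interior (K (n + 1))) ⊆ interior V ∧ V ⊆ p ⁻¹' (K n)ᶜ := by
    refine exists_compact_between (hA _ ((K.isCompact _).diff isOpen_interior))
      ((K.isCompact n).isClosed.isOpen_compl.preimage hp) ?_
    exact fun x hx hxK ↦ hx.2.2 (K.subset_interior_succ n hxK)
  choose V hV hAV hVK using hlayer
  refine ⟨⋃ n, interior (V n), isOpen_iUnion fun _ ↦ isOpen_interior, fun x hx ↦ ?_,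
    fun L hL ↦ ?_⟩
  · have hfind := K.mem_find (p x)
    rcases h : K.find (p x) with _ | _ | n
    · rw [h] at hfind
      exact hfind.elim
    · rw [h] at hfind
      exact hfind.elim
    · refine mem_iUnion.2 ⟨n, hAV n ⟨hx, h ▸ hfind, fun hmem ↦ ?_⟩⟩
      have := K.mem_iff_find_le.1 (interior_subset hmem)
      omega
  · obtain ⟨m, hm⟩ := K.exists_superset_of_isCompact hL
    have hsub : (⋃ n, interior (V n)) ∩ p ⁻¹' interior (K (m + 1)) ⊆ ⋃ n ∈ Iio (m + 1), V n := by
      rintro x ⟨hxU, hxK⟩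
      obtain ⟨n, hn⟩ := mem_iUnion.1 hxU
      refine mem_biUnion (mem_Iio.2 (lt_of_not_ge fun hmn ↦ ?_)) (interior_subset hn)
      exact hVK n (interior_subset hn) (K.subset hmn (interior_subset hxK))
    have hcompact : IsCompact (closure (⋃ n ∈ Iio (m + 1), V n)) :=
      ((finite_Iio _).isCompact_biUnion fun n _ ↦ hV n).closure
    refine hcompact.of_isClosed_subset
      (isClosed_closure.inter (hL.isClosed.preimage hp)) fun x hx ↦ closure_mono hsub ?_
    exact (isOpen_interior.preimage hp).closure_inter ⟨hx.1, K.subset_interior_succ m (hm hx.2)⟩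

/-- If `p : X → Y` is a continuous map between second countable, locally compact Hausdorff
spaces and `A ⊆ X` is a closed set on which `p` restricts to a proper map, then `A` has an
open neighbourhood `U` such that `p` restricted to the closure of `U` is proper. -/
theorem exists_relatively_proper_open_neighbourhood
    {X Y : Type*} [TopologicalSpace X] [SecondCountableTopology X]
    [LocallyCompactSpace X] [T2Space X]
    [TopologicalSpace Y] [SecondCountableTopology Y] [LocallyCompactSpace Y] [T2Space Y]
    (p : X → Y) (hp : Continuous p) (A : Set X) (hA : IsClosed A)
    (hproper : IsProperMap (A.restrict p)) :
    ∃ U : Set X, IsOpen U ∧ A ⊆ U ∧ IsProperMap ((closure U).restrict p) := by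
  obtain ⟨U, hU, hAU, hUK⟩ := exists_isOpen_superset_isCompact_closure_inter_preimage hp
    fun K hK ↦ Subtype.image_preimage_coe A (p ⁻¹' K) ▸
      (hproper.isCompact_preimage hK).image continuous_subtype_val
  refine ⟨U, hU, hAU, isProperMap_iff_isCompact_preimage.2
    ⟨hp.comp continuous_subtype_val, fun K hK ↦ Subtype.isCompact_iff.2 ?_⟩⟩
  change IsCompact (Subtype.val '' (Subtype.val ⁻¹' (p ⁻¹' K)))
  rw [Subtype.image_preimage_coe]
  exact hUK K hK
end

section
/- Let A be a separable C*-algebra and (I_n) an increasing sequence of closed two-sided ideals of A whose union is dense in A. Suppose that for each n there is a sequence (p_{n,k})_k of projections in I_n with lim_k ‖p_{n,k} a p_{n,k} − a‖ = 0 for every a ∈ I_n. Then A contains an approximate unit of projections, i.e., a sequence (q_m) of projections in A with lim_m ‖q_m a q_m − a‖ = 0 for every a ∈ A. -/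
open Filter

theorem norm_le_one_of_isSelfAdjoint_of_mul_self {A : Type*} [NonUnitalCStarAlgebra A] {p : A}
    (hsa : IsSelfAdjoint p) (hidem : p * p = p) : ‖p‖ ≤ 1 := by
  have h : ‖p‖ = ‖p‖ * ‖p‖ := by
    simpa [hsa.star_eq, hidem] using CStarRing.norm_star_mul_self (x := p)
  nlinarith [norm_nonneg p]

/-- Compressing by a contraction `p` is stable under perturbation of the compressed element. -/
theorem norm_mul_mul_sub_le {A : Type*} [NonUnitalNormedRing A] {p : A} (hp : ‖p‖ ≤ 1)
    (a b : A) : ‖p * a * p - a‖ ≤ ‖p * b * p - b‖ + 2 * ‖a - b‖ := by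
  have h : ‖p * (a - b) * p‖ ≤ ‖a - b‖ :=
    calc ‖p * (a - b) * p‖ ≤ ‖p‖ * ‖a - b‖ * ‖p‖ :=
          (norm_mul_le _ _).trans (by gcongr; exact norm_mul_le _ _)
      _ ≤ 1 * ‖a - b‖ * 1 := by gcongr
      _ = ‖a - b‖ := by ring
  have e : p * a * p - a = (p * b * p - b) + (p * (a - b) * p - (a - b)) := by
    rw [mul_sub, sub_mul]; abel
  rw [e]
  linarith [norm_add_le (p * b * p - b) (p * (a - b) * p - (a - b)),
    norm_sub_le (p * (a - b) * p) (a - b)]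

/-- In a separable C*-algebra, projections that approximately fix finite sets under compression
can be arranged into a sequential approximate unit. -/
theorem exists_seq_of_forall_finset_exists_projection
    {A : Type*} [NonUnitalCStarAlgebra A] [TopologicalSpace.SeparableSpace A]
    (h : ∀ (F : Finset A) (ε : ℝ), 0 < ε →
      ∃ q : A, IsSelfAdjoint q ∧ q * q = q ∧ ∀ a ∈ F, ‖q * a * q - a‖ < ε) :
    ∃ q : ℕ → A, (∀ m, IsSelfAdjoint (q m)) ∧ (∀ m, q m * q m = q m) ∧
      ∀ a : A, Tendsto (fun m => ‖q m * a * q m - a‖) atTop (nhds 0) := by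
  classical
  let d := TopologicalSpace.denseSeq A
  choose q hsa hidem hq using fun m : ℕ =>
    h ((Finset.range (m + 1)).image d) (1 / ((m : ℝ) + 1)) (by positivity)
  refine ⟨q, hsa, hidem, fun a => ?_⟩
  rw [Metric.tendsto_atTop]
  intro ε hε
  obtain ⟨j, hj⟩ := (TopologicalSpace.denseRange_denseSeq A).exists_dist_lt a
    (show 0 < ε / 4 by positivity)
  obtain ⟨N, hN⟩ := exists_nat_one_div_lt (show 0 < ε / 2 by positivity)
  refine ⟨max j N, fun m hm => ?_⟩
  have hmN : 1 / ((m : ℝ) + 1) ≤ 1 / ((N : ℝ) + 1) := by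
    have : N ≤ m := (le_max_right _ _).trans hm
    gcongr
  have hd := hq m (d j) (Finset.mem_image_of_mem d
    (Finset.mem_range_succ_iff.2 ((le_max_left _ _).trans hm)))
  have hle := norm_mul_mul_sub_le
    (norm_le_one_of_isSelfAdjoint_of_mul_self (hsa m) (hidem m)) a (d j)
  rw [dist_eq_norm] at hj
  rw [dist_zero_right, norm_norm]
  linarith

/-- If a separable C*-algebra `A` has an increasing sequence of closed two-sided ideals
with dense union, each of which admits an approximate unit of projections, then `A` itself
has an approximate unit of projections. -/
theorem exists_approximate_unit_of_projections
    {A : Type*} [NonUnitalCStarAlgebra A] [TopologicalSpace.SeparableSpace A]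
    (I : ℕ → TwoSidedIdeal A) (hmono : Monotone I)
    (hclosed : ∀ n, IsClosed (I n : Set A))
    (hdense : Dense (⋃ n, (I n : Set A)))
    (p : ℕ → ℕ → A)
    (hpI : ∀ n k, p n k ∈ I n)
    (hpsa : ∀ n k, IsSelfAdjoint (p n k))
    (hpidem : ∀ n k, p n k * p n k = p n k)
    (happrox : ∀ n, ∀ a ∈ I n,
      Tendsto (fun k => ‖p n k * a * p n k - a‖) atTop (nhds 0)) :
    ∃ q : ℕ → A, (∀ m, IsSelfAdjoint (q m)) ∧ (∀ m, q m * q m = q m) ∧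
      ∀ a : A, Tendsto (fun m => ‖q m * a * q m - a‖) atTop (nhds 0) := by
  refine exists_seq_of_forall_finset_exists_projection fun F ε hε => ?_
  have hex : ∀ a : A, ∃ b, ∃ n, b ∈ I n ∧ ‖a - b‖ < ε / 4 := fun a => by
    obtain ⟨b, hb, hab⟩ := hdense.exists_dist_lt a (show 0 < ε / 4 by positivity)
    obtain ⟨n, hn⟩ := Set.mem_iUnion.1 hb
    exact ⟨b, n, hn, by rwa [← dist_eq_norm]⟩
  choose b n hb hab using hex
  have hev : ∀ᶠ k in atTop, ∀ a ∈ F,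
      ‖p (F.sup n) k * b a * p (F.sup n) k - b a‖ < ε / 2 :=
    (Filter.eventually_all_finset F).2 fun a ha =>
      (happrox _ _ (hmono (Finset.le_sup ha) (hb a))).eventually_lt_const (by positivity)
  obtain ⟨k, hk⟩ := hev.exists
  refine ⟨p (F.sup n) k, hpsa _ _, hpidem _ _, fun a ha => ?_⟩
  linarith [hk a ha, hab a, norm_mul_mul_sub_le
    (norm_le_one_of_isSelfAdjoint_of_mul_self (hpsa (F.sup n) k) (hpidem _ _)) a (b a)]
end
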